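/- arXiv:2408.16648 — 7 statements merged into one kernel-verified Lean document; each statement's English description precedes it below -/
import Mathlib

section
/- Let A be the bi-quadratic algebra on three generators over a field 𝕜 with parameters q₁,q₂,q₃ ∈ 𝕜 nonzero and a,b,c,α,β,γ,λ,μ,ν,b₁,b₂,b₃ ∈ 𝕜. Then A has a PBW basis (i.e., the images of the monomials x₁^{a₁}x₂^{a₂}x₃^{a₃}, (a₁,a₂,a₃) ∈ ℕ³, form a basis of A as a 𝕜-vector space) if and only if Bavula's consistency conditions hold: (1−q₃)α = (1−q₂)μ; (1−q₃)a = (1−q₁)ν; (1−q₂)b = (1−q₁)γ; (1−q₁q₂)λ = 0; (q₁−q₃)β = 0; (1−q₂q₃)c = 0; ((1−q₃)α−μ)a + (b+q₁γ)λ − να + (q₁q₂−1)b₃ = 0; (a−ν)β + q₁γμ − q₃αb + (q₁−q₃)b₂ = 0; (a+(q₁−1)ν)γ + bν − (μ+q₃α)c + (1−q₂q₃)b₁ = 0; −(μ+q₃α)b₁ + (a−ν)b₂ + (b+q₁γ)b₃ = 0. -/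
noncomputable section

open FreeAlgebra

/-- The defining relations of the bi-quadratic algebra on three generators:
`x₂x₁ = q₁x₁x₂ + ax₁ + bx₂ + cx₃ + b₁`, `x₃x₁ = q₂x₁x₃ + αx₁ + βx₂ + γx₃ + b₂`,
`x₃x₂ = q₃x₂x₃ + λx₁ + μx₂ + νx₃ + b₃` (here `lam` stands for `λ`).
The quotient `RingQuot` of the free algebra by these relations is exactly the quotient by the
two-sided ideal generated by the elements
`x₂x₁ − q₁x₁x₂ − ax₁ − bx₂ − cx₃ − b₁`, etc. -/
def BQ3Rel (𝕜 : Type*) [Field 𝕜] (q₁ q₂ q₃ a b c α β γ lam μ ν b₁ b₂ b₃ : 𝕜) :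
    FreeAlgebra 𝕜 (Fin 3) → FreeAlgebra 𝕜 (Fin 3) → Prop := fun u v =>
  (u = ι 𝕜 (1 : Fin 3) * ι 𝕜 (0 : Fin 3) ∧
    v = q₁ • (ι 𝕜 (0 : Fin 3) * ι 𝕜 (1 : Fin 3)) + a • ι 𝕜 (0 : Fin 3) + b • ι 𝕜 (1 : Fin 3) +
      c • ι 𝕜 (2 : Fin 3) + algebraMap 𝕜 (FreeAlgebra 𝕜 (Fin 3)) b₁) ∨
  (u = ι 𝕜 (2 : Fin 3) * ι 𝕜 (0 : Fin 3) ∧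
    v = q₂ • (ι 𝕜 (0 : Fin 3) * ι 𝕜 (2 : Fin 3)) + α • ι 𝕜 (0 : Fin 3) + β • ι 𝕜 (1 : Fin 3) +
      γ • ι 𝕜 (2 : Fin 3) + algebraMap 𝕜 (FreeAlgebra 𝕜 (Fin 3)) b₂) ∨
  (u = ι 𝕜 (2 : Fin 3) * ι 𝕜 (1 : Fin 3) ∧
    v = q₃ • (ι 𝕜 (1 : Fin 3) * ι 𝕜 (2 : Fin 3)) + lam • ι 𝕜 (0 : Fin 3) + μ • ι 𝕜 (1 : Fin 3) +
      ν • ι 𝕜 (2 : Fin 3) + algebraMap 𝕜 (FreeAlgebra 𝕜 (Fin 3)) b₃)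

/-- The bi-quadratic algebra on three generators. -/
abbrev BQ3 (𝕜 : Type*) [Field 𝕜] (q₁ q₂ q₃ a b c α β γ lam μ ν b₁ b₂ b₃ : 𝕜) : Type _ :=
  RingQuot (BQ3Rel 𝕜 q₁ q₂ q₃ a b c α β γ lam μ ν b₁ b₂ b₃)

/-- The images of the three generators in the bi-quadratic algebra. -/
def BQ3x (𝕜 : Type*) [Field 𝕜] (q₁ q₂ q₃ a b c α β γ lam μ ν b₁ b₂ b₃ : 𝕜) (i : Fin 3) :
    BQ3 𝕜 q₁ q₂ q₃ a b c α β γ lam μ ν b₁ b₂ b₃ :=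
  RingQuot.mkAlgHom 𝕜 (BQ3Rel 𝕜 q₁ q₂ q₃ a b c α β γ lam μ ν b₁ b₂ b₃) (ι 𝕜 i)

noncomputable section

open Finsupp

namespace BQ3

/-- The free vector space on the exponents of the ordered monomials. -/
abbrev Mon (𝕜 : Type*) [Field 𝕜] : Type _ := (ℕ × ℕ × ℕ) →₀ 𝕜

/-- The basis vector of an ordered monomial. -/
abbrev mon (𝕜 : Type*) [Field 𝕜] (m : ℕ × ℕ × ℕ) : Mon 𝕜 := single m 1

/-- The vectors of total degree at most `d`. -/
def degLE (𝕜 : Type*) [Field 𝕜] (d : ℕ) : Submodule 𝕜 (Mon 𝕜) :=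
  Submodule.span 𝕜 (mon 𝕜 '' {m | m.1 + m.2.1 + m.2.2 ≤ d})

/-- Left multiplication by the first generator. -/
def opX (𝕜 : Type*) [Field 𝕜] : Mon 𝕜 →ₗ[𝕜] Mon 𝕜 :=
  lmapDomain 𝕜 𝕜 fun m => (m.1 + 1, m.2)

variable {𝕜 : Type*} [Field 𝕜]

@[simp]
lemma opX_mon (m : ℕ × ℕ × ℕ) : opX 𝕜 (mon 𝕜 m) = mon 𝕜 (m.1 + 1, m.2) := by
  simp [opX, mon]

lemma mon_mem_degLE {m : ℕ × ℕ × ℕ} {d : ℕ} (h : m.1 + m.2.1 + m.2.2 ≤ d) :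
    mon 𝕜 m ∈ degLE 𝕜 d :=
  Submodule.subset_span ⟨m, h, rfl⟩

lemma degLE_mono {d d' : ℕ} (h : d ≤ d') : degLE 𝕜 d ≤ degLE 𝕜 d' :=
  Submodule.span_mono <| Set.image_mono fun _ hm => le_trans hm h

lemma degLE_le {d : ℕ} {S : Submodule 𝕜 (Mon 𝕜)}
    (h : ∀ m : ℕ × ℕ × ℕ, m.1 + m.2.1 + m.2.2 ≤ d → mon 𝕜 m ∈ S) : degLE 𝕜 d ≤ S := by
  rw [degLE, Submodule.span_le]
  rintro _ ⟨m, hm, rfl⟩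
  exact h m hm

lemma eq_on_degLE {M : Type*} [AddCommGroup M] [Module 𝕜 M] {d : ℕ} {f g : Mon 𝕜 →ₗ[𝕜] M}
    (h : ∀ m : ℕ × ℕ × ℕ, m.1 + m.2.1 + m.2.2 ≤ d → f (mon 𝕜 m) = g (mon 𝕜 m))
    {v : Mon 𝕜} (hv : v ∈ degLE 𝕜 d) : f v = g v :=
  degLE_le (S := LinearMap.eqLocus f g) h hv

lemma opX_mem {d : ℕ} {v : Mon 𝕜} (hv : v ∈ degLE 𝕜 d) : opX 𝕜 v ∈ degLE 𝕜 (d + 1) := by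
  refine degLE_le (S := (degLE 𝕜 (d + 1)).comap (opX 𝕜)) (fun m hm => ?_) hv
  rw [Submodule.mem_comap, opX_mon]
  exact mon_mem_degLE (by simp only; omega)

/-- One step of the recursion for left multiplication by the second generator. -/
def stepY (q₁ a b c b₁ : 𝕜) (Y Z : Mon 𝕜 →ₗ[𝕜] Mon 𝕜) : Mon 𝕜 →ₗ[𝕜] Mon 𝕜 :=
  Finsupp.linearCombination 𝕜 fun m => match m with
    | (0, j, k) => mon 𝕜 (0, j + 1, k)
    | (i + 1, j, k) => q₁ • opX 𝕜 (Y (mon 𝕜 (i, j, k))) + a • opX 𝕜 (mon 𝕜 (i, j, k)) +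
        b • Y (mon 𝕜 (i, j, k)) + c • Z (mon 𝕜 (i, j, k)) + b₁ • mon 𝕜 (i, j, k)

/-- One step of the recursion for left multiplication by the third generator; `Y'` is the
already improved approximation to left multiplication by the second generator. -/
def stepZ (q₂ q₃ α β γ lam μ ν b₂ b₃ : 𝕜) (Y' Y Z : Mon 𝕜 →ₗ[𝕜] Mon 𝕜) :
    Mon 𝕜 →ₗ[𝕜] Mon 𝕜 :=
  Finsupp.linearCombination 𝕜 fun m => match m with
    | (0, 0, k) => mon 𝕜 (0, 0, k + 1)
    | (0, j + 1, k) => q₃ • Y' (Z (mon 𝕜 (0, j, k))) + lam • opX 𝕜 (mon 𝕜 (0, j, k)) +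
        μ • Y (mon 𝕜 (0, j, k)) + ν • Z (mon 𝕜 (0, j, k)) + b₃ • mon 𝕜 (0, j, k)
    | (i + 1, j, k) => q₂ • opX 𝕜 (Z (mon 𝕜 (i, j, k))) + α • opX 𝕜 (mon 𝕜 (i, j, k)) +
        β • Y (mon 𝕜 (i, j, k)) + γ • Z (mon 𝕜 (i, j, k)) + b₂ • mon 𝕜 (i, j, k)

/-- Successive approximations to left multiplication by the second and third generators; the
`n`-th one is correct in degrees less than `n`. -/
def approx (q₁ q₂ q₃ a b c α β γ lam μ ν b₁ b₂ b₃ : 𝕜) :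
    ℕ → (Mon 𝕜 →ₗ[𝕜] Mon 𝕜) × (Mon 𝕜 →ₗ[𝕜] Mon 𝕜)
  | 0 => (0, 0)
  | n + 1 =>
    let p := approx q₁ q₂ q₃ a b c α β γ lam μ ν b₁ b₂ b₃ n
    (stepY q₁ a b c b₁ p.1 p.2,
      stepZ q₂ q₃ α β γ lam μ ν b₂ b₃ (stepY q₁ a b c b₁ p.1 p.2) p.1 p.2)

lemma stepY_mem (q₁ a b c b₁ : 𝕜) {Y Z : Mon 𝕜 →ₗ[𝕜] Mon 𝕜} {n : ℕ}
    (hY : ∀ d < n, ∀ v ∈ degLE 𝕜 d, Y v ∈ degLE 𝕜 (d + 1))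
    (hZ : ∀ d < n, ∀ v ∈ degLE 𝕜 d, Z v ∈ degLE 𝕜 (d + 1)) :
    ∀ d < n + 1, ∀ v ∈ degLE 𝕜 d, stepY q₁ a b c b₁ Y Z v ∈ degLE 𝕜 (d + 1) := by
  intro d hd v hv
  refine degLE_le (S := (degLE 𝕜 (d + 1)).comap (stepY q₁ a b c b₁ Y Z)) ?_ hv
  rintro ⟨_ | i, j, k⟩ hm <;> simp only at hm
  · simpa [stepY] using mon_mem_degLE (𝕜 := 𝕜) (m := (0, j + 1, k)) (d := d + 1)
      (by simp only; omega)
  · obtain ⟨d, rfl⟩ : ∃ d', d = d' + 1 := ⟨d - 1, by omega⟩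
    have he : mon 𝕜 (i, j, k) ∈ degLE 𝕜 d := mon_mem_degLE (by simp only; omega)
    have h1 := hY d (by omega) _ he
    have h2 := hZ d (by omega) _ he
    have hle : degLE 𝕜 (d + 1) ≤ degLE 𝕜 (d + 1 + 1) := degLE_mono (by omega)
    simp only [Submodule.mem_comap, stepY, linearCombination_single, one_smul]
    exact add_mem (add_mem (add_mem (add_mem (Submodule.smul_mem _ _ (opX_mem h1))
      (Submodule.smul_mem _ _ (hle (opX_mem he)))) (Submodule.smul_mem _ _ (hle h1)))
      (Submodule.smul_mem _ _ (hle h2))) (Submodule.smul_mem _ _ (degLE_mono (by omega) he))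

lemma stepZ_mem (q₂ q₃ α β γ lam μ ν b₂ b₃ : 𝕜) {Y' Y Z : Mon 𝕜 →ₗ[𝕜] Mon 𝕜} {n : ℕ}
    (hY' : ∀ d < n + 1, ∀ v ∈ degLE 𝕜 d, Y' v ∈ degLE 𝕜 (d + 1))
    (hY : ∀ d < n, ∀ v ∈ degLE 𝕜 d, Y v ∈ degLE 𝕜 (d + 1))
    (hZ : ∀ d < n, ∀ v ∈ degLE 𝕜 d, Z v ∈ degLE 𝕜 (d + 1)) :
    ∀ d < n + 1, ∀ v ∈ degLE 𝕜 d,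
      stepZ q₂ q₃ α β γ lam μ ν b₂ b₃ Y' Y Z v ∈ degLE 𝕜 (d + 1) := by
  intro d hd v hv
  refine degLE_le
    (S := (degLE 𝕜 (d + 1)).comap (stepZ q₂ q₃ α β γ lam μ ν b₂ b₃ Y' Y Z)) ?_ hv
  rintro ⟨_ | i, j, k⟩ hm <;> simp only at hm
  · obtain _ | j := j
    · simpa [stepZ] using mon_mem_degLE (𝕜 := 𝕜) (m := (0, 0, k + 1)) (d := d + 1)
        (by simp only; omega)
    obtain ⟨d, rfl⟩ : ∃ d', d = d' + 1 := ⟨d - 1, by omega⟩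
    have he : mon 𝕜 (0, j, k) ∈ degLE 𝕜 d := mon_mem_degLE (by simp only; omega)
    have h1 := hY d (by omega) _ he
    have h2 := hZ d (by omega) _ he
    have h3 := hY' (d + 1) hd _ h2
    have hle : degLE 𝕜 (d + 1) ≤ degLE 𝕜 (d + 1 + 1) := degLE_mono (by omega)
    simp only [Submodule.mem_comap, stepZ, linearCombination_single, one_smul]
    exact add_mem (add_mem (add_mem (add_mem (Submodule.smul_mem _ _ h3)
      (Submodule.smul_mem _ _ (hle (opX_mem he)))) (Submodule.smul_mem _ _ (hle h1)))
      (Submodule.smul_mem _ _ (hle h2))) (Submodule.smul_mem _ _ (degLE_mono (by omega) he))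
  · obtain ⟨d, rfl⟩ : ∃ d', d = d' + 1 := ⟨d - 1, by omega⟩
    have he : mon 𝕜 (i, j, k) ∈ degLE 𝕜 d := mon_mem_degLE (by simp only; omega)
    have h1 := hY d (by omega) _ he
    have h2 := hZ d (by omega) _ he
    have hle : degLE 𝕜 (d + 1) ≤ degLE 𝕜 (d + 1 + 1) := degLE_mono (by omega)
    simp only [Submodule.mem_comap, stepZ, linearCombination_single, one_smul]
    exact add_mem (add_mem (add_mem (add_mem (Submodule.smul_mem _ _ (opX_mem h2))
      (Submodule.smul_mem _ _ (hle (opX_mem he)))) (Submodule.smul_mem _ _ (hle h1)))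
      (Submodule.smul_mem _ _ (hle h2))) (Submodule.smul_mem _ _ (degLE_mono (by omega) he))

lemma stepY_congr (q₁ a b c b₁ : 𝕜) {Y Z Y₁ Z₁ : Mon 𝕜 →ₗ[𝕜] Mon 𝕜} {n : ℕ}
    (hY : ∀ d < n, ∀ v ∈ degLE 𝕜 d, Y₁ v = Y v) (hZ : ∀ d < n, ∀ v ∈ degLE 𝕜 d, Z₁ v = Z v) :
    ∀ d < n + 1, ∀ v ∈ degLE 𝕜 d, stepY q₁ a b c b₁ Y₁ Z₁ v = stepY q₁ a b c b₁ Y Z v := by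
  intro d hd v hv
  refine eq_on_degLE ?_ hv
  rintro ⟨_ | i, j, k⟩ hm <;> simp only at hm
  · simp [stepY]
  · have he : mon 𝕜 (i, j, k) ∈ degLE 𝕜 (d - 1) := mon_mem_degLE (by simp only; omega)
    simp only [stepY, linearCombination_single, one_smul, hY _ (by omega) _ he,
      hZ _ (by omega) _ he]

lemma stepZ_congr (q₂ q₃ α β γ lam μ ν b₂ b₃ : 𝕜) {Y' Y Z Y₁' Y₁ Z₁ : Mon 𝕜 →ₗ[𝕜] Mon 𝕜} {n : ℕ}
    (hY' : ∀ d < n + 1, ∀ v ∈ degLE 𝕜 d, Y₁' v = Y' v)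
    (hY : ∀ d < n, ∀ v ∈ degLE 𝕜 d, Y₁ v = Y v) (hZ : ∀ d < n, ∀ v ∈ degLE 𝕜 d, Z₁ v = Z v)
    (hZm : ∀ d < n, ∀ v ∈ degLE 𝕜 d, Z v ∈ degLE 𝕜 (d + 1)) :
    ∀ d < n + 1, ∀ v ∈ degLE 𝕜 d, stepZ q₂ q₃ α β γ lam μ ν b₂ b₃ Y₁' Y₁ Z₁ v =
      stepZ q₂ q₃ α β γ lam μ ν b₂ b₃ Y' Y Z v := by
  intro d hd v hv
  refine eq_on_degLE ?_ hv
  rintro ⟨_ | i, j, k⟩ hm <;> simp only at hm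
  · obtain _ | j := j
    · simp [stepZ]
    have he : mon 𝕜 (0, j, k) ∈ degLE 𝕜 (d - 1) := mon_mem_degLE (by simp only; omega)
    simp only [stepZ, linearCombination_single, one_smul, hY _ (by omega) _ he,
      hZ _ (by omega) _ he, hY' _ (by omega) _ (hZm _ (by omega) _ he)]
  · have he : mon 𝕜 (i, j, k) ∈ degLE 𝕜 (d - 1) := mon_mem_degLE (by simp only; omega)
    simp only [stepZ, linearCombination_single, one_smul, hY _ (by omega) _ he,
      hZ _ (by omega) _ he]

/-- Left multiplication by the second and third generators on the space of ordered monomials,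
characterised by the defining relations wherever these determine it. -/
theorem exists_operators (q₁ q₂ q₃ a b c α β γ lam μ ν b₁ b₂ b₃ : 𝕜) :
    ∃ Y Z : Mon 𝕜 →ₗ[𝕜] Mon 𝕜,
      (∀ d, ∀ v ∈ degLE 𝕜 d, Z v ∈ degLE 𝕜 (d + 1)) ∧
      (∀ j k, Y (mon 𝕜 (0, j, k)) = mon 𝕜 (0, j + 1, k)) ∧
      (∀ k, Z (mon 𝕜 (0, 0, k)) = mon 𝕜 (0, 0, k + 1)) ∧
      (∀ v, Y (opX 𝕜 v) = q₁ • opX 𝕜 (Y v) + a • opX 𝕜 v + b • Y v + c • Z v + b₁ • v) ∧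
      (∀ v, Z (opX 𝕜 v) = q₂ • opX 𝕜 (Z v) + α • opX 𝕜 v + β • Y v + γ • Z v + b₂ • v) ∧
      (∀ j k, Z (Y (mon 𝕜 (0, j, k))) = q₃ • Y (Z (mon 𝕜 (0, j, k))) +
        lam • opX 𝕜 (mon 𝕜 (0, j, k)) + μ • Y (mon 𝕜 (0, j, k)) + ν • Z (mon 𝕜 (0, j, k)) +
        b₃ • mon 𝕜 (0, j, k)) := by
  set p := approx q₁ q₂ q₃ a b c α β γ lam μ ν b₁ b₂ b₃
  have p1 (n : ℕ) : (p (n + 1)).1 = stepY q₁ a b c b₁ (p n).1 (p n).2 := rfl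
  have p2 (n : ℕ) : (p (n + 1)).2 =
    stepZ q₂ q₃ α β γ lam μ ν b₂ b₃ (p (n + 1)).1 (p n).1 (p n).2 := rfl
  clear_value p
  have mem (n : ℕ) : (∀ d < n, ∀ v ∈ degLE 𝕜 d, (p n).1 v ∈ degLE 𝕜 (d + 1)) ∧
      (∀ d < n, ∀ v ∈ degLE 𝕜 d, (p n).2 v ∈ degLE 𝕜 (d + 1)) := by
    induction n with
    | zero => simp
    | succ n ih =>
      have h := stepY_mem q₁ a b c b₁ ih.1 ih.2
      rw [← p1] at h
      exact ⟨h, by rw [p2]; exact stepZ_mem _ _ _ _ _ _ _ _ _ _ h ih.1 ih.2⟩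
  have stable (n : ℕ) : (∀ d < n, ∀ v ∈ degLE 𝕜 d, (p (n + 1)).1 v = (p n).1 v) ∧
      (∀ d < n, ∀ v ∈ degLE 𝕜 d, (p (n + 1)).2 v = (p n).2 v) := by
    induction n with
    | zero => simp
    | succ n ih =>
      have h := stepY_congr q₁ a b c b₁ ih.1 ih.2
      rw [← p1, ← p1] at h
      refine ⟨h, ?_⟩
      have h' := stepZ_congr q₂ q₃ α β γ lam μ ν b₂ b₃ h ih.1 ih.2 (mem n).2
      rwa [← p2, ← p2] at h'
  have stable_le {n n' : ℕ} (hn : n ≤ n') {d : ℕ} (hd : d < n) {v : Mon 𝕜}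
      (hv : v ∈ degLE 𝕜 d) : (p n').1 v = (p n).1 v ∧ (p n').2 v = (p n).2 v := by
    induction n', hn using Nat.le_induction with
    | base => exact ⟨rfl, rfl⟩
    | succ n' hn ih =>
      exact ⟨((stable n').1 d (by omega) v hv).trans ih.1,
        ((stable n').2 d (by omega) v hv).trans ih.2⟩
  let Y : Mon 𝕜 →ₗ[𝕜] Mon 𝕜 :=
    linearCombination 𝕜 fun m => (p (m.1 + m.2.1 + m.2.2 + 1)).1 (mon 𝕜 m)
  let Z : Mon 𝕜 →ₗ[𝕜] Mon 𝕜 :=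
    linearCombination 𝕜 fun m => (p (m.1 + m.2.1 + m.2.2 + 1)).2 (mon 𝕜 m)
  have hY {n d : ℕ} (hd : d < n) {v : Mon 𝕜} (hv : v ∈ degLE 𝕜 d) : Y v = (p n).1 v := by
    refine eq_on_degLE (fun m hm => ?_) hv
    simp only [Y, linearCombination_single, one_smul]
    exact (stable_le (by omega) (Nat.lt_succ_self _) (mon_mem_degLE le_rfl)).1.symm
  have hZ {n d : ℕ} (hd : d < n) {v : Mon 𝕜} (hv : v ∈ degLE 𝕜 d) : Z v = (p n).2 v := by
    refine eq_on_degLE (fun m hm => ?_) hv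
    simp only [Z, linearCombination_single, one_smul]
    exact (stable_le (by omega) (Nat.lt_succ_self _) (mon_mem_degLE le_rfl)).2.symm
  have hZm : ∀ d, ∀ v ∈ degLE 𝕜 d, Z v ∈ degLE 𝕜 (d + 1) := fun d v hv => by
    rw [hZ (Nat.lt_succ_self d) hv]
    exact (mem _).2 d (Nat.lt_succ_self d) v hv
  have hY0 (j k : ℕ) : Y (mon 𝕜 (0, j, k)) = mon 𝕜 (0, j + 1, k) := by
    simp [Y, p1, stepY]
  refine ⟨Y, Z, hZm, hY0, fun k => by simp [Z, p2, stepZ], fun v => ?_, fun v => ?_, fun j k => ?_⟩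
  · suffices h : Y ∘ₗ opX 𝕜 = q₁ • (opX 𝕜 ∘ₗ Y) + a • opX 𝕜 + b • Y + c • Z +
        b₁ • LinearMap.id from LinearMap.congr_fun h v
    refine Finsupp.lhom_ext' fun ⟨i, j, k⟩ => LinearMap.ext_ring ?_
    have he : mon 𝕜 (i, j, k) ∈ degLE 𝕜 (i + j + k) := mon_mem_degLE le_rfl
    change Y (opX 𝕜 (mon 𝕜 (i, j, k))) = q₁ • opX 𝕜 (Y (mon 𝕜 (i, j, k))) +
      a • opX 𝕜 (mon 𝕜 (i, j, k)) + b • Y (mon 𝕜 (i, j, k)) + c • Z (mon 𝕜 (i, j, k)) +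
      b₁ • mon 𝕜 (i, j, k)
    rw [hY (Nat.lt_succ_self _) (opX_mem he), hY (Nat.lt_succ_self _) he,
      hZ (Nat.lt_succ_self _) he, Nat.succ_eq_add_one, p1]
    nth_rewrite 1 [opX_mon]
    simp only [stepY, linearCombination_single, one_smul]
  · suffices h : Z ∘ₗ opX 𝕜 = q₂ • (opX 𝕜 ∘ₗ Z) + α • opX 𝕜 + β • Y + γ • Z +
        b₂ • LinearMap.id from LinearMap.congr_fun h v
    refine Finsupp.lhom_ext' fun ⟨i, j, k⟩ => LinearMap.ext_ring ?_
    have he : mon 𝕜 (i, j, k) ∈ degLE 𝕜 (i + j + k) := mon_mem_degLE le_rfl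
    change Z (opX 𝕜 (mon 𝕜 (i, j, k))) = q₂ • opX 𝕜 (Z (mon 𝕜 (i, j, k))) +
      α • opX 𝕜 (mon 𝕜 (i, j, k)) + β • Y (mon 𝕜 (i, j, k)) + γ • Z (mon 𝕜 (i, j, k)) +
      b₂ • mon 𝕜 (i, j, k)
    rw [hZ (Nat.lt_succ_self _) (opX_mem he), hY (Nat.lt_succ_self _) he,
      hZ (Nat.lt_succ_self _) he, Nat.succ_eq_add_one, p2]
    nth_rewrite 1 [opX_mon]
    simp only [stepZ, linearCombination_single, one_smul]
  · have he : mon 𝕜 (0, j, k) ∈ degLE 𝕜 (j + k) := mon_mem_degLE (by simp)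
    have he' : mon 𝕜 (0, j + 1, k) ∈ degLE 𝕜 (j + k + 1) := mon_mem_degLE (by simp only; omega)
    nth_rewrite 1 [hY0 j k]
    rw [hY (Nat.lt_succ_self _) (hZm _ _ he), hZ (Nat.lt_succ_self _) he,
      hZ (Nat.lt_succ_self _) he', hY (Nat.lt_succ_self _) he, Nat.succ_eq_add_one,
      Nat.succ_eq_add_one]
    nth_rewrite 1 [p2]
    simp only [stepZ, linearCombination_single, one_smul]

/-- The diamond computation: the two reductions of `z * y * x` in an algebra satisfying the
bi-quadratic relations. -/
lemma overlap {A : Type*} [Ring A] [Algebra 𝕜 A] {q₁ q₂ q₃ a b c α β γ lam μ ν b₁ b₂ b₃ : 𝕜}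
    {x y z : A} (hyx : y * x = q₁ • (x * y) + a • x + b • y + c • z + b₁ • 1)
    (hzx : z * x = q₂ • (x * z) + α • x + β • y + γ • z + b₂ • 1)
    (hzy : z * y = q₃ • (y * z) + lam • x + μ • y + ν • z + b₃ • 1) :
    (q₁ * ((q₃ - 1) * α + (1 - q₂) * μ)) • (x * y) +
    (q₂ * ((q₃ - 1) * a + (1 - q₁) * ν)) • (x * z) +
    (q₃ * ((q₂ - 1) * b + (1 - q₁) * γ)) • (y * z) +
    ((1 - q₁ * q₂) * lam) • (x * x) + ((q₃ - q₁) * β) • (y * y) +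
    ((q₂ * q₃ - 1) * c) • (z * z) +
    (-(((1 - q₃) * α - μ) * a + (b + q₁ * γ) * lam - ν * α + (q₁ * q₂ - 1) * b₃)) • x +
    (-((a - ν) * β + q₁ * γ * μ - q₃ * α * b + (q₁ - q₃) * b₂)) • y +
    (-((a + (q₁ - 1) * ν) * γ + b * ν - (μ + q₃ * α) * c + (1 - q₂ * q₃) * b₁)) • z +
    (-(-(μ + q₃ * α) * b₁ + (a - ν) * b₂ + (b + q₁ * γ) * b₃)) • (1 : A) = 0 := by
  have hassoc : (z * y) * x = z * (y * x) := mul_assoc z y x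
  have e1 := congrArg (· * z) hyx
  have e2 := congrArg (y * ·) hzx
  have e3 := congrArg (· * y) hzx
  have e4 := congrArg (x * ·) hzy
  rw [hyx, hzy] at hassoc
  simp only [add_mul, mul_add, smul_mul_assoc, mul_smul_comm, one_mul, mul_one, mul_assoc]
    at hassoc e1 e2 e3 e4
  rw [e2, e3, e4, e1, hyx, hzx, hzy] at hassoc
  linear_combination (norm := module) hassoc

/-- The ordered monomials in three elements of an algebra, extended linearly. -/
def fromMon {A : Type*} [Ring A] [Algebra 𝕜 A] (x y z : A) : Mon 𝕜 →ₗ[𝕜] A :=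
  linearCombination 𝕜 fun m : ℕ × ℕ × ℕ => x ^ m.1 * y ^ m.2.1 * z ^ m.2.2

lemma fromMon_mon {A : Type*} [Ring A] [Algebra 𝕜 A] (x y z : A) (m : ℕ × ℕ × ℕ) :
    fromMon x y z (mon 𝕜 m) = x ^ m.1 * y ^ m.2.1 * z ^ m.2.2 := by
  simp [fromMon]

lemma fromMon_opX {A : Type*} [Ring A] [Algebra 𝕜 A] (x y z : A) (v : Mon 𝕜) :
    fromMon x y z (opX 𝕜 v) = x * fromMon x y z v := by
  suffices h : fromMon x y z ∘ₗ opX 𝕜 = LinearMap.mulLeft 𝕜 x ∘ₗ fromMon x y z from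
    LinearMap.congr_fun h v
  refine Finsupp.lhom_ext' fun m => LinearMap.ext_ring ?_
  change fromMon x y z (opX 𝕜 (mon 𝕜 m)) = x * fromMon x y z (mon 𝕜 m)
  rw [opX_mon, fromMon_mon, fromMon_mon, pow_succ', mul_assoc, mul_assoc, mul_assoc]

/-- The operators of `exists_operators` are intertwined by `fromMon` with left multiplications. -/
lemma fromMon_operators {A : Type*} [Ring A] [Algebra 𝕜 A]
    {q₁ q₂ q₃ a b c α β γ lam μ ν b₁ b₂ b₃ : 𝕜} {x y z : A}
    (hyx : y * x = q₁ • (x * y) + a • x + b • y + c • z + b₁ • 1)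
    (hzx : z * x = q₂ • (x * z) + α • x + β • y + γ • z + b₂ • 1)
    (hzy : z * y = q₃ • (y * z) + lam • x + μ • y + ν • z + b₃ • 1)
    {Y Z : Mon 𝕜 →ₗ[𝕜] Mon 𝕜} (hZm : ∀ d, ∀ v ∈ degLE 𝕜 d, Z v ∈ degLE 𝕜 (d + 1))
    (hY0 : ∀ j k, Y (mon 𝕜 (0, j, k)) = mon 𝕜 (0, j + 1, k))
    (hZ0 : ∀ k, Z (mon 𝕜 (0, 0, k)) = mon 𝕜 (0, 0, k + 1))
    (hYX : ∀ v, Y (opX 𝕜 v) = q₁ • opX 𝕜 (Y v) + a • opX 𝕜 v + b • Y v + c • Z v + b₁ • v)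
    (hZX : ∀ v, Z (opX 𝕜 v) = q₂ • opX 𝕜 (Z v) + α • opX 𝕜 v + β • Y v + γ • Z v + b₂ • v)
    (hZY : ∀ j k, Z (Y (mon 𝕜 (0, j, k))) = q₃ • Y (Z (mon 𝕜 (0, j, k))) +
        lam • opX 𝕜 (mon 𝕜 (0, j, k)) + μ • Y (mon 𝕜 (0, j, k)) + ν • Z (mon 𝕜 (0, j, k)) +
        b₃ • mon 𝕜 (0, j, k)) (v : Mon 𝕜) :
    fromMon x y z (Y v) = y * fromMon x y z v ∧ fromMon x y z (Z v) = z * fromMon x y z v := by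
  have main (d : ℕ) : ∀ v ∈ degLE 𝕜 d,
      fromMon x y z (Y v) = y * fromMon x y z v ∧ fromMon x y z (Z v) = z * fromMon x y z v := by
    induction d using Nat.strong_induction_on with
    | _ d ih =>
      have hYd : ∀ v ∈ degLE 𝕜 d, fromMon x y z (Y v) = y * fromMon x y z v := by
        intro v hv
        refine eq_on_degLE (f := fromMon x y z ∘ₗ Y) (g := LinearMap.mulLeft 𝕜 y ∘ₗ fromMon x y z)
          ?_ hv
        rintro ⟨_ | i, j, k⟩ hm <;> simp only at hm
        · simp only [LinearMap.comp_apply, LinearMap.mulLeft_apply, hY0, fromMon_mon, pow_zero,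
            one_mul, pow_succ', mul_assoc]
        · obtain ⟨h1, h2⟩ := ih (d - 1) (by omega) (mon 𝕜 (i, j, k))
            (mon_mem_degLE (by simp only; omega))
          have hX : mon 𝕜 (i + 1, j, k) = opX 𝕜 (mon 𝕜 (i, j, k)) :=
            (opX_mon (i, j, k)).symm
          simp only [LinearMap.comp_apply, LinearMap.mulLeft_apply]
          rw [hX, hYX, fromMon_opX, ← mul_assoc, hyx]
          simp only [map_add, map_smul, fromMon_opX, h1, h2, add_mul, smul_mul_assoc, mul_assoc,
            one_mul]
      refine fun v hv => ⟨hYd v hv, ?_⟩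
      refine eq_on_degLE (f := fromMon x y z ∘ₗ Z) (g := LinearMap.mulLeft 𝕜 z ∘ₗ fromMon x y z)
        ?_ hv
      rintro ⟨_ | i, j, k⟩ hm <;> simp only at hm
      · obtain _ | j := j
        · simp only [LinearMap.comp_apply, LinearMap.mulLeft_apply, hZ0, fromMon_mon, pow_zero,
            one_mul, pow_succ']
        have he : mon 𝕜 (0, j, k) ∈ degLE 𝕜 (d - 1) := mon_mem_degLE (by simp only; omega)
        obtain ⟨h1, h2⟩ := ih (d - 1) (by omega) _ he
        have h3 := hYd _ (degLE_mono (by omega) (hZm _ _ he))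
        simp only [LinearMap.comp_apply, LinearMap.mulLeft_apply]
        rw [← hY0, hZY, h1, ← mul_assoc, hzy]
        simp only [map_add, map_smul, fromMon_opX, h1, h2, h3, add_mul, smul_mul_assoc, mul_assoc,
          one_mul]
      · obtain ⟨h1, h2⟩ := ih (d - 1) (by omega) (mon 𝕜 (i, j, k))
          (mon_mem_degLE (by simp only; omega))
        have hX : mon 𝕜 (i + 1, j, k) = opX 𝕜 (mon 𝕜 (i, j, k)) :=
          (opX_mon (i, j, k)).symm
        simp only [LinearMap.comp_apply, LinearMap.mulLeft_apply]
        rw [hX, hZX, fromMon_opX, ← mul_assoc, hzx]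
        simp only [map_add, map_smul, fromMon_opX, h1, h2, add_mul, smul_mul_assoc, mul_assoc,
          one_mul]
  induction v using Finsupp.induction_linear with
  | zero => simp
  | add f g hf hg => simp [hf, hg, mul_add]
  | single m r =>
    have h := main _ _ (mon_mem_degLE (𝕜 := 𝕜) (m := m) le_rfl)
    rw [← mul_one r, ← smul_eq_mul, ← smul_single]
    simp only [map_smul, h, mul_smul_comm, and_self]

lemma quotient_relations (q₁ q₂ q₃ a b c α β γ lam μ ν b₁ b₂ b₃ : 𝕜) :
    let x := BQ3x 𝕜 q₁ q₂ q₃ a b c α β γ lam μ ν b₁ b₂ b₃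
    x 1 * x 0 = q₁ • (x 0 * x 1) + a • x 0 + b • x 1 + c • x 2 + b₁ • 1 ∧
    x 2 * x 0 = q₂ • (x 0 * x 2) + α • x 0 + β • x 1 + γ • x 2 + b₂ • 1 ∧
    x 2 * x 1 = q₃ • (x 1 * x 2) + lam • x 0 + μ • x 1 + ν • x 2 + b₃ • 1 := by
  have key {u v} (h : BQ3Rel 𝕜 q₁ q₂ q₃ a b c α β γ lam μ ν b₁ b₂ b₃ u v) :
      RingQuot.mkAlgHom 𝕜 (BQ3Rel 𝕜 q₁ q₂ q₃ a b c α β γ lam μ ν b₁ b₂ b₃) u =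
        RingQuot.mkAlgHom 𝕜 (BQ3Rel 𝕜 q₁ q₂ q₃ a b c α β γ lam μ ν b₁ b₂ b₃) v :=
    RingQuot.mkAlgHom_rel 𝕜 h
  refine ⟨?_, ?_, ?_⟩
  · simpa [BQ3x, Algebra.algebraMap_eq_smul_one] using key (Or.inl ⟨rfl, rfl⟩)
  · simpa [BQ3x, Algebra.algebraMap_eq_smul_one] using key (Or.inr (Or.inl ⟨rfl, rfl⟩))
  · simpa [BQ3x, Algebra.algebraMap_eq_smul_one] using key (Or.inr (Or.inr ⟨rfl, rfl⟩))

/-- The ordered monomials span the bi-quadratic algebra, whatever the parameters. -/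
theorem span_monomials (q₁ q₂ q₃ a b c α β γ lam μ ν b₁ b₂ b₃ : 𝕜) :
    Submodule.span 𝕜 (Set.range (fun m : ℕ × ℕ × ℕ =>
        BQ3x 𝕜 q₁ q₂ q₃ a b c α β γ lam μ ν b₁ b₂ b₃ 0 ^ m.1 *
        BQ3x 𝕜 q₁ q₂ q₃ a b c α β γ lam μ ν b₁ b₂ b₃ 1 ^ m.2.1 *
        BQ3x 𝕜 q₁ q₂ q₃ a b c α β γ lam μ ν b₁ b₂ b₃ 2 ^ m.2.2)) = ⊤ := by
  obtain ⟨Y, Z, hZm, hY0, hZ0, hYX, hZX, hZY⟩ :=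
    exists_operators q₁ q₂ q₃ a b c α β γ lam μ ν b₁ b₂ b₃
  obtain ⟨hyx, hzx, hzy⟩ := quotient_relations q₁ q₂ q₃ a b c α β γ lam μ ν b₁ b₂ b₃
  set x := BQ3x 𝕜 q₁ q₂ q₃ a b c α β γ lam μ ν b₁ b₂ b₃
  have hE := fromMon_operators hyx hzx hzy hZm hY0 hZ0 hYX hZX hZY
  rw [← Finsupp.range_linearCombination, LinearMap.range_eq_top]
  change Function.Surjective (fromMon (𝕜 := 𝕜) (x 0) (x 1) (x 2))
  have stable (f : FreeAlgebra 𝕜 (Fin 3)) : ∀ v : Mon 𝕜, ∃ w : Mon 𝕜, fromMon (x 0) (x 1) (x 2) w =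
      RingQuot.mkAlgHom 𝕜 (BQ3Rel 𝕜 q₁ q₂ q₃ a b c α β γ lam μ ν b₁ b₂ b₃) f *
        fromMon (x 0) (x 1) (x 2) v := by
    induction f using FreeAlgebra.induction with
    | grade0 r => exact fun v => ⟨r • v, by simp [Algebra.algebraMap_eq_smul_one]⟩
    | grade1 i =>
      intro v
      fin_cases i
      · exact ⟨opX 𝕜 v, fromMon_opX _ _ _ v⟩
      · exact ⟨Y v, (hE v).1⟩
      · exact ⟨Z v, (hE v).2⟩
    | mul f g hf hg =>
      intro v
      obtain ⟨w, hw⟩ := hg v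
      obtain ⟨w', hw'⟩ := hf w
      exact ⟨w', by rw [hw', hw, map_mul, mul_assoc]⟩
    | add f g hf hg =>
      intro v
      obtain ⟨w, hw⟩ := hf v
      obtain ⟨w', hw'⟩ := hg v
      exact ⟨w + w', by rw [map_add, map_add, hw, hw', add_mul]⟩
  intro u
  obtain ⟨f, rfl⟩ := RingQuot.mkAlgHom_surjective 𝕜
    (BQ3Rel 𝕜 q₁ q₂ q₃ a b c α β γ lam μ ν b₁ b₂ b₃) u
  obtain ⟨w, hw⟩ := stable f (mon 𝕜 (0, 0, 0))
  exact ⟨w, by rw [hw, fromMon_mon]; simp⟩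

/-- Linear independence of the ordered monomials forces the ambiguity `x₃x₂x₁` to have vanishing
coefficients. -/
theorem coeffs_eq_zero {A : Type*} [Ring A] [Algebra 𝕜 A] {x y z : A}
    (h : LinearIndependent 𝕜 fun m : ℕ × ℕ × ℕ => x ^ m.1 * y ^ m.2.1 * z ^ m.2.2)
    {r₁ r₂ r₃ r₄ r₅ r₆ r₇ r₈ r₉ r₁₀ : 𝕜}
    (h0 : r₁ • (x * y) + r₂ • (x * z) + r₃ • (y * z) + r₄ • (x * x) + r₅ • (y * y) +
      r₆ • (z * z) + r₇ • x + r₈ • y + r₉ • z + r₁₀ • (1 : A) = 0) :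
    r₁ = 0 ∧ r₂ = 0 ∧ r₃ = 0 ∧ r₄ = 0 ∧ r₅ = 0 ∧ r₆ = 0 ∧ r₇ = 0 ∧ r₈ = 0 ∧ r₉ = 0 ∧ r₁₀ = 0 := by
  have hf := linearIndependent_iff.1 h (r₁ • mon 𝕜 (1, 1, 0) + r₂ • mon 𝕜 (1, 0, 1) +
    r₃ • mon 𝕜 (0, 1, 1) + r₄ • mon 𝕜 (2, 0, 0) + r₅ • mon 𝕜 (0, 2, 0) +
    r₆ • mon 𝕜 (0, 0, 2) + r₇ • mon 𝕜 (1, 0, 0) + r₈ • mon 𝕜 (0, 1, 0) +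
    r₉ • mon 𝕜 (0, 0, 1) + r₁₀ • mon 𝕜 (0, 0, 0))
    (by simpa only [map_add, map_smul, linearCombination_single, one_smul, pow_zero, pow_one,
      one_mul, mul_one, pow_two] using h0)
  refine ⟨?_, ?_, ?_, ?_, ?_, ?_, ?_, ?_, ?_, ?_⟩
  · simpa [single_apply] using DFunLike.congr_fun hf (1, 1, 0)
  · simpa [single_apply] using DFunLike.congr_fun hf (1, 0, 1)
  · simpa [single_apply] using DFunLike.congr_fun hf (0, 1, 1)
  · simpa [single_apply] using DFunLike.congr_fun hf (2, 0, 0)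
  · simpa [single_apply] using DFunLike.congr_fun hf (0, 2, 0)
  · simpa [single_apply] using DFunLike.congr_fun hf (0, 0, 2)
  · simpa [single_apply] using DFunLike.congr_fun hf (1, 0, 0)
  · simpa [single_apply] using DFunLike.congr_fun hf (0, 1, 0)
  · simpa [single_apply] using DFunLike.congr_fun hf (0, 0, 1)
  · simpa [single_apply] using DFunLike.congr_fun hf (0, 0, 0)

/-- Operators satisfying the bi-quadratic relations and acting on the ordered monomials as left
multiplications make the ordered monomials of the bi-quadratic algebra linearly independent. -/
theorem linearIndependent_of_operators {q₁ q₂ q₃ a b c α β γ lam μ ν b₁ b₂ b₃ : 𝕜}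
    {Y Z : Mon 𝕜 →ₗ[𝕜] Mon 𝕜}
    (hY0 : ∀ j k, Y (mon 𝕜 (0, j, k)) = mon 𝕜 (0, j + 1, k))
    (hZ0 : ∀ k, Z (mon 𝕜 (0, 0, k)) = mon 𝕜 (0, 0, k + 1))
    (hYX : ∀ v, Y (opX 𝕜 v) = q₁ • opX 𝕜 (Y v) + a • opX 𝕜 v + b • Y v + c • Z v + b₁ • v)
    (hZX : ∀ v, Z (opX 𝕜 v) = q₂ • opX 𝕜 (Z v) + α • opX 𝕜 v + β • Y v + γ • Z v + b₂ • v)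
    (hZY : ∀ v, Z (Y v) = q₃ • Y (Z v) + lam • opX 𝕜 v + μ • Y v + ν • Z v + b₃ • v) :
    LinearIndependent 𝕜 (fun m : ℕ × ℕ × ℕ =>
        BQ3x 𝕜 q₁ q₂ q₃ a b c α β γ lam μ ν b₁ b₂ b₃ 0 ^ m.1 *
        BQ3x 𝕜 q₁ q₂ q₃ a b c α β γ lam μ ν b₁ b₂ b₃ 1 ^ m.2.1 *
        BQ3x 𝕜 q₁ q₂ q₃ a b c α β γ lam μ ν b₁ b₂ b₃ 2 ^ m.2.2) := by
  let F : FreeAlgebra 𝕜 (Fin 3) →ₐ[𝕜] Module.End 𝕜 (Mon 𝕜) :=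
    FreeAlgebra.lift 𝕜 ![opX 𝕜, Y, Z]
  have hF ⦃u v⦄ (h : BQ3Rel 𝕜 q₁ q₂ q₃ a b c α β γ lam μ ν b₁ b₂ b₃ u v) : F u = F v := by
    refine LinearMap.ext fun w => ?_
    rcases h with ⟨rfl, rfl⟩ | ⟨rfl, rfl⟩ | ⟨rfl, rfl⟩
    · simpa [F, Algebra.algebraMap_eq_smul_one] using hYX w
    · simpa [F, Algebra.algebraMap_eq_smul_one] using hZX w
    · simpa [F, Algebra.algebraMap_eq_smul_one] using hZY w
  let ρ : BQ3 𝕜 q₁ q₂ q₃ a b c α β γ lam μ ν b₁ b₂ b₃ →ₐ[𝕜] Module.End 𝕜 (Mon 𝕜) :=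
    RingQuot.liftAlgHom 𝕜 ⟨F, hF⟩
  have hρ (i : Fin 3) : ρ (BQ3x 𝕜 q₁ q₂ q₃ a b c α β γ lam μ ν b₁ b₂ b₃ i) =
      ![opX 𝕜, Y, Z] i := by
    simp [ρ, BQ3x, F]
  have hZk (k : ℕ) : (Z ^ k) (mon 𝕜 (0, 0, 0)) = mon 𝕜 (0, 0, k) := by
    induction k with
    | zero => simp
    | succ k ih => rw [pow_succ', Module.End.mul_apply, ih, hZ0]
  have hYj (j k : ℕ) : (Y ^ j) (mon 𝕜 (0, 0, k)) = mon 𝕜 (0, j, k) := by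
    induction j with
    | zero => simp
    | succ j ih => rw [pow_succ', Module.End.mul_apply, ih, hY0]
  have hXi (i j k : ℕ) : (opX 𝕜 ^ i) (mon 𝕜 (0, j, k)) = mon 𝕜 (i, j, k) := by
    induction i with
    | zero => simp
    | succ i ih => rw [pow_succ', Module.End.mul_apply, ih, opX_mon]
  refine LinearIndependent.of_comp (LinearMap.applyₗ (mon 𝕜 (0, 0, 0)) ∘ₗ ρ.toLinearMap) ?_
  convert (Finsupp.basisSingleOne (R := 𝕜) (ι := ℕ × ℕ × ℕ)).linearIndependent using 1
  funext ⟨i, j, k⟩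
  simp [hρ, hZk, hYj, hXi]

/-- Under the consistency conditions, the third relation propagates from monomials not
involving the first generator to all monomials. -/
lemma operator_relation {q₁ q₂ q₃ a b c α β γ lam μ ν b₁ b₂ b₃ : 𝕜}
    (h₁ : (1 - q₃) * α = (1 - q₂) * μ) (h₂ : (1 - q₃) * a = (1 - q₁) * ν)
    (h₃ : (1 - q₂) * b = (1 - q₁) * γ) (h₄ : (1 - q₁ * q₂) * lam = 0)
    (h₅ : (q₁ - q₃) * β = 0) (h₆ : (1 - q₂ * q₃) * c = 0)
    (h₇ : ((1 - q₃) * α - μ) * a + (b + q₁ * γ) * lam - ν * α + (q₁ * q₂ - 1) * b₃ = 0)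
    (h₈ : (a - ν) * β + q₁ * γ * μ - q₃ * α * b + (q₁ - q₃) * b₂ = 0)
    (h₉ : (a + (q₁ - 1) * ν) * γ + b * ν - (μ + q₃ * α) * c + (1 - q₂ * q₃) * b₁ = 0)
    (h₁₀ : -(μ + q₃ * α) * b₁ + (a - ν) * b₂ + (b + q₁ * γ) * b₃ = 0)
    {Y Z : Mon 𝕜 →ₗ[𝕜] Mon 𝕜}
    (hYX : ∀ v, Y (opX 𝕜 v) = q₁ • opX 𝕜 (Y v) + a • opX 𝕜 v + b • Y v + c • Z v + b₁ • v)
    (hZX : ∀ v, Z (opX 𝕜 v) = q₂ • opX 𝕜 (Z v) + α • opX 𝕜 v + β • Y v + γ • Z v + b₂ • v)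
    (hZY : ∀ j k, Z (Y (mon 𝕜 (0, j, k))) = q₃ • Y (Z (mon 𝕜 (0, j, k))) +
        lam • opX 𝕜 (mon 𝕜 (0, j, k)) + μ • Y (mon 𝕜 (0, j, k)) + ν • Z (mon 𝕜 (0, j, k)) +
        b₃ • mon 𝕜 (0, j, k)) (v : Mon 𝕜) :
    Z (Y v) = q₃ • Y (Z v) + lam • opX 𝕜 v + μ • Y v + ν • Z v + b₃ • v := by
  have main (i j k : ℕ) : Z (Y (mon 𝕜 (i, j, k))) = q₃ • Y (Z (mon 𝕜 (i, j, k))) +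
      lam • opX 𝕜 (mon 𝕜 (i, j, k)) + μ • Y (mon 𝕜 (i, j, k)) + ν • Z (mon 𝕜 (i, j, k)) +
      b₃ • mon 𝕜 (i, j, k) := by
    induction i with
    | zero => exact hZY j k
    | succ i ih =>
      have hX : mon 𝕜 (i + 1, j, k) = opX 𝕜 (mon 𝕜 (i, j, k)) :=
        (opX_mon (i, j, k)).symm
      rw [hX]
      generalize mon 𝕜 (i, j, k) = e at ih
      simp only [hYX, hZX, ih, map_add, map_smul]
      linear_combination (norm := module) (q₁ * h₁) • opX 𝕜 (Y e) + (q₂ * h₂) • opX 𝕜 (Z e) +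
        (q₃ * h₃) • Y (Z e) - h₄ • opX 𝕜 (opX 𝕜 e) + h₅ • Y (Y e) + h₆ • Z (Z e) +
        h₇ • opX 𝕜 e + h₈ • Y e + h₉ • Z e + h₁₀ • e
  suffices h : Z ∘ₗ Y = q₃ • (Y ∘ₗ Z) + lam • opX 𝕜 + μ • Y + ν • Z + b₃ • LinearMap.id from
    LinearMap.congr_fun h v
  exact Finsupp.lhom_ext' fun ⟨i, j, k⟩ => LinearMap.ext_ring (main i j k)

end BQ3

end

/-- Bavula's theorem: the bi-quadratic algebra on three generators has a PBW basis if and only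
if the consistency conditions hold. -/
theorem biquadratic_pbw_iff_consistency (𝕜 : Type*) [Field 𝕜] (q₁ q₂ q₃ a b c α β γ lam μ ν b₁ b₂ b₃ : 𝕜)
    (hq₁ : q₁ ≠ 0) (hq₂ : q₂ ≠ 0) (hq₃ : q₃ ≠ 0) :
    (LinearIndependent 𝕜 (fun m : ℕ × ℕ × ℕ =>
        BQ3x 𝕜 q₁ q₂ q₃ a b c α β γ lam μ ν b₁ b₂ b₃ 0 ^ m.1 *
        BQ3x 𝕜 q₁ q₂ q₃ a b c α β γ lam μ ν b₁ b₂ b₃ 1 ^ m.2.1 *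
        BQ3x 𝕜 q₁ q₂ q₃ a b c α β γ lam μ ν b₁ b₂ b₃ 2 ^ m.2.2) ∧
      Submodule.span 𝕜 (Set.range (fun m : ℕ × ℕ × ℕ =>
        BQ3x 𝕜 q₁ q₂ q₃ a b c α β γ lam μ ν b₁ b₂ b₃ 0 ^ m.1 *
        BQ3x 𝕜 q₁ q₂ q₃ a b c α β γ lam μ ν b₁ b₂ b₃ 1 ^ m.2.1 *
        BQ3x 𝕜 q₁ q₂ q₃ a b c α β γ lam μ ν b₁ b₂ b₃ 2 ^ m.2.2)) = ⊤) ↔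
    ((1 - q₃) * α = (1 - q₂) * μ ∧
      (1 - q₃) * a = (1 - q₁) * ν ∧
      (1 - q₂) * b = (1 - q₁) * γ ∧
      (1 - q₁ * q₂) * lam = 0 ∧
      (q₁ - q₃) * β = 0 ∧
      (1 - q₂ * q₃) * c = 0 ∧
      ((1 - q₃) * α - μ) * a + (b + q₁ * γ) * lam - ν * α + (q₁ * q₂ - 1) * b₃ = 0 ∧
      (a - ν) * β + q₁ * γ * μ - q₃ * α * b + (q₁ - q₃) * b₂ = 0 ∧
      (a + (q₁ - 1) * ν) * γ + b * ν - (μ + q₃ * α) * c + (1 - q₂ * q₃) * b₁ = 0 ∧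
      -(μ + q₃ * α) * b₁ + (a - ν) * b₂ + (b + q₁ * γ) * b₃ = 0) := by
  constructor
  · rintro ⟨hli, -⟩
    obtain ⟨hyx, hzx, hzy⟩ := BQ3.quotient_relations q₁ q₂ q₃ a b c α β γ lam μ ν b₁ b₂ b₃
    obtain ⟨h₁, h₂, h₃, h₄, h₅, h₆, h₇, h₈, h₉, h₁₀⟩ :=
      BQ3.coeffs_eq_zero hli (BQ3.overlap hyx hzx hzy)
    have h₁ := (mul_eq_zero.1 h₁).resolve_left hq₁
    have h₂ := (mul_eq_zero.1 h₂).resolve_left hq₂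
    have h₃ := (mul_eq_zero.1 h₃).resolve_left hq₃
    refine ⟨?_, ?_, ?_, h₄, ?_, ?_, neg_eq_zero.1 h₇, neg_eq_zero.1 h₈, neg_eq_zero.1 h₉,
      neg_eq_zero.1 h₁₀⟩
    · linear_combination -h₁
    · linear_combination -h₂
    · linear_combination -h₃
    · linear_combination -h₅
    · linear_combination -h₆
  · rintro ⟨h₁, h₂, h₃, h₄, h₅, h₆, h₇, h₈, h₉, h₁₀⟩
    refine ⟨?_, BQ3.span_monomials q₁ q₂ q₃ a b c α β γ lam μ ν b₁ b₂ b₃⟩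
    obtain ⟨Y, Z, -, hY0, hZ0, hYX, hZX, hZY⟩ :=
      BQ3.exists_operators q₁ q₂ q₃ a b c α β γ lam μ ν b₁ b₂ b₃
    exact BQ3.linearIndependent_of_operators hY0 hZ0 hYX hZX
      (BQ3.operator_relation h₁ h₂ h₃ h₄ h₅ h₆ h₇ h₈ h₉ h₁₀ hYX hZX hZY)
end
end

section
/- Let A be the bi-quadratic algebra on three generators over a field 𝕜 with parameters q₁,q₂,q₃ ∈ 𝕜 nonzero and a,b,c,α,β,γ,λ,μ,ν,b₁,b₂,b₃ ∈ 𝕜. If the images of the monomials x₁^{a₁}x₂^{a₂}x₃^{a₃}, (a₁,a₂,a₃) ∈ ℕ³, form a basis of A as a 𝕜-vector space, then for every permutation σ of {1,2,3} the images of the monomials x_{σ(1)}^{a₁}x_{σ(2)}^{a₂}x_{σ(3)}^{a₃}, (a₁,a₂,a₃) ∈ ℕ³, also form a basis of A as a 𝕜-vector space. -/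
noncomputable section

open FreeAlgebra

/-- The ordered monomial `y₀ ^ m₀ * y₁ ^ m₁ * y₂ ^ m₂`. -/
def orderedMonomial {A : Type*} [Monoid A] (y : Fin 3 → A) (m : ℕ × ℕ × ℕ) : A :=
  y 0 ^ m.1 * y 1 ^ m.2.1 * y 2 ^ m.2.2

/-- The exponents of total degree at most `n`. -/
def degreeLE (n : ℕ) : Set (ℕ × ℕ × ℕ) := {m | m.1 + m.2.1 + m.2.2 ≤ n}

theorem degreeLE_mono {k n : ℕ} (h : k ≤ n) : degreeLE k ⊆ degreeLE n :=
  fun _ hm => le_trans hm h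

theorem finite_degreeLE (n : ℕ) : (degreeLE n).Finite := by
  refine ((Set.finite_Iic n).prod ((Set.finite_Iic n).prod (Set.finite_Iic n))).subset ?_
  rintro ⟨i, j, k⟩ h
  simp only [degreeLE, Set.mem_ofPred_eq] at h
  simp only [Set.mem_prod, Set.mem_Iic]
  omega

section

variable {𝕜 A : Type*} [Field 𝕜] [Ring A] [Algebra 𝕜 A] {M : Submodule 𝕜 A} {y : Fin 3 → A}

theorem orderedMonomial_mem_pow (hy : ∀ i, y i ∈ M) (m : ℕ × ℕ × ℕ) :
    orderedMonomial y m ∈ M ^ (m.1 + m.2.1 + m.2.2) := by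
  rw [pow_add, pow_add]
  exact Submodule.mul_mem_mul (Submodule.mul_mem_mul (Submodule.pow_mem_pow _ (hy 0) _)
    (Submodule.pow_mem_pow _ (hy 1) _)) (Submodule.pow_mem_pow _ (hy 2) _)

/-- If `u` and `v` commute up to a scalar modulo `M`, then so do `u` and `v ^ n`
modulo `M ^ n`. -/
theorem exists_mul_pow_sub_smul_mem {u v : A} (hv : v ∈ M)
    (huv : ∃ r : 𝕜, u * v - r • (v * u) ∈ M) (n : ℕ) :
    ∃ r : 𝕜, u * v ^ n - r • (v ^ n * u) ∈ M ^ n := by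
  obtain ⟨s, hs⟩ := huv
  induction n with
  | zero => exact ⟨1, by simp⟩
  | succ n ih =>
    obtain ⟨r, hr⟩ := ih
    refine ⟨r * s, ?_⟩
    have h₁ := Submodule.mul_mem_mul hr hv
    have h₂ := Submodule.smul_mem _ r
      (Submodule.mul_mem_mul (Submodule.pow_mem_pow _ hv n) hs)
    rw [← pow_succ] at h₁ h₂
    convert add_mem h₁ h₂ using 1
    simp only [pow_succ, mul_sub, sub_mul, smul_sub, mul_smul_comm, smul_mul_assoc, mul_smul,
      mul_assoc]
    abel

theorem mul_orderedMonomial_mem (hy : ∀ i, y i ∈ M)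
    (hcomm : ∀ i j, ∃ r : 𝕜, y i * y j - r • (y j * y i) ∈ M) (i : Fin 3) (m : ℕ × ℕ × ℕ) :
    ∃ (m' : ℕ × ℕ × ℕ) (r : 𝕜), m'.1 + m'.2.1 + m'.2.2 = m.1 + m.2.1 + m.2.2 + 1 ∧
      y i * orderedMonomial y m - r • orderedMonomial y m' ∈ M ^ (m.1 + m.2.1 + m.2.2) := by
  obtain ⟨k, l, p⟩ := m
  have h₁ := Submodule.pow_mem_pow _ (hy 0) k
  have h₂ := Submodule.pow_mem_pow _ (hy 1) l
  have h₃ := Submodule.pow_mem_pow _ (hy 2) p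
  fin_cases i
  · refine ⟨(k + 1, l, p), 1, by dsimp only; omega, ?_⟩
    simp [orderedMonomial, pow_succ', mul_assoc]
  · obtain ⟨r, hr⟩ := exists_mul_pow_sub_smul_mem (hy 0) (hcomm 1 0) k
    refine ⟨(k, l + 1, p), r, by dsimp only; omega, ?_⟩
    have h := Submodule.mul_mem_mul (Submodule.mul_mem_mul hr h₂) h₃
    rw [← pow_add, ← pow_add] at h
    convert h using 1
    simp [orderedMonomial, pow_succ', mul_assoc, sub_mul]
  · obtain ⟨r, hr⟩ := exists_mul_pow_sub_smul_mem (hy 0) (hcomm 2 0) k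
    obtain ⟨s, hs⟩ := exists_mul_pow_sub_smul_mem (hy 1) (hcomm 2 1) l
    refine ⟨(k, l, p + 1), r * s, by dsimp only; omega, ?_⟩
    have h := Submodule.mul_mem_mul (Submodule.mul_mem_mul hr h₂) h₃
    have h' := Submodule.smul_mem _ r (Submodule.mul_mem_mul (Submodule.mul_mem_mul h₁ hs) h₃)
    rw [← pow_add, ← pow_add] at h h'
    convert add_mem h h' using 1
    simp [orderedMonomial, pow_succ', mul_assoc, sub_mul, mul_sub, smul_sub, mul_smul]

/-- If the `yᵢ` commute pairwise up to scalars modulo the span `M` of `1` and the `yᵢ`, then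
`M ^ n` is spanned by the ordered monomials of degree at most `n`. -/
theorem span_orderedMonomial_degreeLE (hM : M = 1 ⊔ Submodule.span 𝕜 (Set.range y))
    (hcomm : ∀ i j, ∃ r : 𝕜, y i * y j - r • (y j * y i) ∈ M) (n : ℕ) :
    Submodule.span 𝕜 (orderedMonomial y '' degreeLE n) = M ^ n := by
  have h1 : 1 ≤ M := hM ▸ le_sup_left
  have hy : ∀ i, y i ∈ M := fun i =>
    hM ▸ Submodule.mem_sup_right (Submodule.subset_span ⟨i, rfl⟩)
  apply le_antisymm
  · rw [Submodule.span_le]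
    rintro _ ⟨m, hm, rfl⟩
    exact pow_le_pow_right₀ h1 hm (orderedMonomial_mem_pow hy m)
  induction n with
  | zero =>
    rw [pow_zero, Submodule.one_eq_span, Submodule.span_singleton_le_iff_mem]
    exact Submodule.subset_span ⟨(0, 0, 0), le_refl 0, by simp [orderedMonomial]⟩
  | succ n ih =>
    set S := Submodule.span 𝕜 (orderedMonomial y '' degreeLE (n + 1))
    have hle : Submodule.span 𝕜 (orderedMonomial y '' degreeLE n) ≤ S :=
      Submodule.span_mono (Set.image_mono (degreeLE_mono n.le_succ))
    rw [pow_succ', Submodule.mul_le]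
    intro u hu v hv
    have hu' : u ∈ 1 ⊔ Submodule.span 𝕜 (Set.range y) := hM ▸ hu
    obtain ⟨u₁, hu₁, u₂, hu₂, rfl⟩ := Submodule.mem_sup.1 hu'
    obtain ⟨t, rfl⟩ := Submodule.mem_one.1 hu₁
    rw [add_mul, ← Algebra.smul_def]
    refine add_mem (S.smul_mem _ (hle (ih hv))) ?_
    have hmul := Submodule.mul_mem_mul hu₂ (ih hv)
    rw [Submodule.span_mul_span] at hmul
    refine Submodule.span_le.2 ?_ hmul
    rintro _ ⟨_, ⟨i, rfl⟩, _, ⟨m, hm, rfl⟩, rfl⟩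
    obtain ⟨m', r, hm', hr⟩ := mul_orderedMonomial_mem hy hcomm i m
    have hdeg : m' ∈ degreeLE (n + 1) := hm'.trans_le (Nat.succ_le_succ hm)
    have hlow := hle (ih (pow_le_pow_right₀ h1 hm hr))
    change y i * orderedMonomial y m ∈ S
    rw [← sub_add_cancel (y i * orderedMonomial y m) (r • orderedMonomial y m')]
    exact add_mem hlow (S.smul_mem r (Submodule.subset_span ⟨m', hdeg, rfl⟩))

theorem linearIndependent_iff_degreeLE {f : ℕ × ℕ × ℕ → A} :
    LinearIndependent 𝕜 f ↔ ∀ n, LinearIndepOn 𝕜 f (degreeLE n) := by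
  refine ⟨fun h n => h.linearIndepOn _, fun h => ?_⟩
  rw [linearIndependent_iff_finset_linearIndependent]
  intro s
  refine (h (s.sup fun m => m.1 + m.2.1 + m.2.2)).mono fun m hm => ?_
  exact Finset.le_sup (f := fun m : ℕ × ℕ × ℕ => m.1 + m.2.1 + m.2.2) hm

theorem linearIndependent_orderedMonomial {z : Fin 3 → A}
    (hspan : ∀ n, Submodule.span 𝕜 (orderedMonomial y '' degreeLE n) =
      Submodule.span 𝕜 (orderedMonomial z '' degreeLE n))
    (h : LinearIndependent 𝕜 (orderedMonomial y)) :
    LinearIndependent 𝕜 (orderedMonomial z) := by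
  rw [linearIndependent_iff_degreeLE] at h ⊢
  intro n
  have : Fintype (degreeLE n) := (finite_degreeLE n).fintype
  have hn := linearIndependent_iff_card_eq_finrank_span.1 (h n)
  refine linearIndependent_iff_card_eq_finrank_span.2 (hn.trans ?_)
  rw [Set.finrank, Set.finrank, ← Set.image_eq_range, ← Set.image_eq_range, hspan]

/-- If the generators commute pairwise up to scalars modulo the span of `1` and the generators,
then reordering the generators preserves PBW bases. -/
theorem orderedMonomial_basis_perm
    (hcomm : ∀ i j, ∃ r : 𝕜,
      y i * y j - r • (y j * y i) ∈ 1 ⊔ Submodule.span 𝕜 (Set.range y))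
    (hli : LinearIndependent 𝕜 (orderedMonomial y))
    (hsp : Submodule.span 𝕜 (Set.range (orderedMonomial y)) = ⊤) (σ : Equiv.Perm (Fin 3)) :
    LinearIndependent 𝕜 (orderedMonomial (y ∘ σ)) ∧
      Submodule.span 𝕜 (Set.range (orderedMonomial (y ∘ σ))) = ⊤ := by
  have hspan : ∀ n, Submodule.span 𝕜 (orderedMonomial y '' degreeLE n) =
      Submodule.span 𝕜 (orderedMonomial (y ∘ σ) '' degreeLE n) := fun n =>
    (span_orderedMonomial_degreeLE rfl hcomm n).trans
      (span_orderedMonomial_degreeLE (y := y ∘ σ)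
        (by rw [σ.surjective.range_comp]) (fun i j => hcomm (σ i) (σ j)) n).symm
  refine ⟨linearIndependent_orderedMonomial hspan hli, ?_⟩
  rw [eq_top_iff, ← hsp, Submodule.span_le]
  rintro _ ⟨m, rfl⟩
  refine Submodule.span_mono (Set.image_subset_range _ (degreeLE (m.1 + m.2.1 + m.2.2))) ?_
  rw [← hspan]
  exact Submodule.subset_span ⟨m, le_refl (m.1 + m.2.1 + m.2.2), rfl⟩

/-- A relation `u * v = q • (v * u) + l` with `q ≠ 0` and `l ∈ M` can be read in both directions. -/
theorem sub_inv_smul_mem_of_sub_smul_mem {u v : A} {q : 𝕜} (hq : q ≠ 0)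
    (h : u * v - q • (v * u) ∈ M) : v * u - q⁻¹ • (u * v) ∈ M := by
  convert M.smul_mem (-q⁻¹) h using 1
  rw [smul_sub, neg_smul, neg_smul, inv_smul_smul₀ hq]
  abel

theorem affine_mem (y : Fin 3 → A) (r s t w : 𝕜) :
    r • y 0 + s • y 1 + t • y 2 + algebraMap 𝕜 A w ∈
      1 ⊔ Submodule.span 𝕜 (Set.range y) := by
  have hy : ∀ i, y i ∈ 1 ⊔ Submodule.span 𝕜 (Set.range y) := fun i =>
    Submodule.mem_sup_right (Submodule.subset_span ⟨i, rfl⟩)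
  exact add_mem (add_mem (add_mem (Submodule.smul_mem _ _ (hy 0)) (Submodule.smul_mem _ _ (hy 1)))
    (Submodule.smul_mem _ _ (hy 2))) (Submodule.mem_sup_left (Submodule.mem_one.2 ⟨w, rfl⟩))

end

theorem BQ3x_commute_modulo (𝕜 : Type*) [Field 𝕜]
    (q₁ q₂ q₃ a b c α β γ lam μ ν b₁ b₂ b₃ : 𝕜)
    (hq₁ : q₁ ≠ 0) (hq₂ : q₂ ≠ 0) (hq₃ : q₃ ≠ 0) (i j : Fin 3) :
    ∃ r : 𝕜, BQ3x 𝕜 q₁ q₂ q₃ a b c α β γ lam μ ν b₁ b₂ b₃ i *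
        BQ3x 𝕜 q₁ q₂ q₃ a b c α β γ lam μ ν b₁ b₂ b₃ j -
      r • (BQ3x 𝕜 q₁ q₂ q₃ a b c α β γ lam μ ν b₁ b₂ b₃ j *
        BQ3x 𝕜 q₁ q₂ q₃ a b c α β γ lam μ ν b₁ b₂ b₃ i) ∈
      1 ⊔ Submodule.span 𝕜 (Set.range (BQ3x 𝕜 q₁ q₂ q₃ a b c α β γ lam μ ν b₁ b₂ b₃)) := by
  set x := BQ3x 𝕜 q₁ q₂ q₃ a b c α β γ lam μ ν b₁ b₂ b₃ with hx
  have h10 : x 1 * x 0 - q₁ • (x 0 * x 1) ∈ 1 ⊔ Submodule.span 𝕜 (Set.range x) := by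
    have h := RingQuot.mkAlgHom_rel 𝕜
      (s := BQ3Rel 𝕜 q₁ q₂ q₃ a b c α β γ lam μ ν b₁ b₂ b₃) (Or.inl ⟨rfl, rfl⟩)
    simp only [map_add, map_mul, map_smul, AlgHom.commutes] at h
    convert affine_mem x a b c b₁ using 1
    rw [sub_eq_iff_eq_add']
    simpa only [hx, BQ3x, add_assoc] using h
  have h20 : x 2 * x 0 - q₂ • (x 0 * x 2) ∈ 1 ⊔ Submodule.span 𝕜 (Set.range x) := by
    have h := RingQuot.mkAlgHom_rel 𝕜
      (s := BQ3Rel 𝕜 q₁ q₂ q₃ a b c α β γ lam μ ν b₁ b₂ b₃) (Or.inr (Or.inl ⟨rfl, rfl⟩))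
    simp only [map_add, map_mul, map_smul, AlgHom.commutes] at h
    convert affine_mem x α β γ b₂ using 1
    rw [sub_eq_iff_eq_add']
    simpa only [hx, BQ3x, add_assoc] using h
  have h21 : x 2 * x 1 - q₃ • (x 1 * x 2) ∈ 1 ⊔ Submodule.span 𝕜 (Set.range x) := by
    have h := RingQuot.mkAlgHom_rel 𝕜
      (s := BQ3Rel 𝕜 q₁ q₂ q₃ a b c α β γ lam μ ν b₁ b₂ b₃) (Or.inr (Or.inr ⟨rfl, rfl⟩))
    simp only [map_add, map_mul, map_smul, AlgHom.commutes] at h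
    convert affine_mem x lam μ ν b₃ using 1
    rw [sub_eq_iff_eq_add']
    simpa only [hx, BQ3x, add_assoc] using h
  fin_cases i <;> fin_cases j
  · exact ⟨1, by simp⟩
  · exact ⟨_, sub_inv_smul_mem_of_sub_smul_mem hq₁ h10⟩
  · exact ⟨_, sub_inv_smul_mem_of_sub_smul_mem hq₂ h20⟩
  · exact ⟨_, h10⟩
  · exact ⟨1, by simp⟩
  · exact ⟨_, sub_inv_smul_mem_of_sub_smul_mem hq₃ h21⟩
  · exact ⟨_, h20⟩
  · exact ⟨_, h21⟩
  · exact ⟨1, by simp⟩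

/-- If the standard monomials form a PBW basis of the bi-quadratic algebra on three generators,
then so do the monomials in any permuted order of the generators. -/
theorem biquadratic_pbw_perm (𝕜 : Type*) [Field 𝕜] (q₁ q₂ q₃ a b c α β γ lam μ ν b₁ b₂ b₃ : 𝕜)
    (hq₁ : q₁ ≠ 0) (hq₂ : q₂ ≠ 0) (hq₃ : q₃ ≠ 0)
    (hpbw : LinearIndependent 𝕜 (fun m : ℕ × ℕ × ℕ =>
        BQ3x 𝕜 q₁ q₂ q₃ a b c α β γ lam μ ν b₁ b₂ b₃ 0 ^ m.1 *
        BQ3x 𝕜 q₁ q₂ q₃ a b c α β γ lam μ ν b₁ b₂ b₃ 1 ^ m.2.1 *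
        BQ3x 𝕜 q₁ q₂ q₃ a b c α β γ lam μ ν b₁ b₂ b₃ 2 ^ m.2.2) ∧
      Submodule.span 𝕜 (Set.range (fun m : ℕ × ℕ × ℕ =>
        BQ3x 𝕜 q₁ q₂ q₃ a b c α β γ lam μ ν b₁ b₂ b₃ 0 ^ m.1 *
        BQ3x 𝕜 q₁ q₂ q₃ a b c α β γ lam μ ν b₁ b₂ b₃ 1 ^ m.2.1 *
        BQ3x 𝕜 q₁ q₂ q₃ a b c α β γ lam μ ν b₁ b₂ b₃ 2 ^ m.2.2)) = ⊤) :
    ∀ σ : Equiv.Perm (Fin 3),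
      LinearIndependent 𝕜 (fun m : ℕ × ℕ × ℕ =>
          BQ3x 𝕜 q₁ q₂ q₃ a b c α β γ lam μ ν b₁ b₂ b₃ (σ 0) ^ m.1 *
          BQ3x 𝕜 q₁ q₂ q₃ a b c α β γ lam μ ν b₁ b₂ b₃ (σ 1) ^ m.2.1 *
          BQ3x 𝕜 q₁ q₂ q₃ a b c α β γ lam μ ν b₁ b₂ b₃ (σ 2) ^ m.2.2) ∧
        Submodule.span 𝕜 (Set.range (fun m : ℕ × ℕ × ℕ =>
          BQ3x 𝕜 q₁ q₂ q₃ a b c α β γ lam μ ν b₁ b₂ b₃ (σ 0) ^ m.1 *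
          BQ3x 𝕜 q₁ q₂ q₃ a b c α β γ lam μ ν b₁ b₂ b₃ (σ 1) ^ m.2.1 *
          BQ3x 𝕜 q₁ q₂ q₃ a b c α β γ lam μ ν b₁ b₂ b₃ (σ 2) ^ m.2.2)) = ⊤ := by
  have h := orderedMonomial_basis_perm
    (BQ3x_commute_modulo 𝕜 q₁ q₂ q₃ a b c α β γ lam μ ν b₁ b₂ b₃ hq₁ hq₂ hq₃)
  exact h hpbw.1 hpbw.2
end
end

section
/- Let 𝕜 be a field, q ∈ 𝕜 nonzero and a,b,c ∈ 𝕜, and let B = 𝕜⟨x₁,x₂⟩/⟨x₂x₁ − qx₁x₂ − ax₁ − bx₂ − c⟩ be the bi-quadratic algebra on two generators. Then B is isomorphic as a 𝕜-algebra to one of the following five algebras: (1) the commutative polynomial algebra 𝕜[x₁,x₂]; (2) the Weyl algebra A₁(𝕜) = 𝕜⟨x₁,x₂⟩/⟨x₂x₁ − x₁x₂ + 1⟩; (3) the enveloping algebra U(𝔫₂) = 𝕜⟨x₁,x₂⟩/⟨x₂x₁ − x₁x₂ − x₁⟩; (4) a quantum plane 𝕜⟨x₁,x₂⟩/⟨x₂x₁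 − q'x₁x₂⟩ for some q' ∈ 𝕜 with q' ≠ 0 and q' ≠ 1; (5) a quantum Weyl algebra 𝕜⟨x₁,x₂⟩/⟨x₂x₁ − q'x₁x₂ − 1⟩ for some q' ∈ 𝕜 with q' ≠ 0 and q' ≠ 1. -/
noncomputable section

open FreeAlgebra

/-- The defining relation of the bi-quadratic algebra on two generators:
`x₂x₁ = qx₁x₂ + ax₁ + bx₂ + c`.  The quotient `RingQuot` of the free algebra by this relation is
exactly the quotient by the two-sided ideal generated by `x₂x₁ − qx₁x₂ − ax₁ − bx₂ − c`. -/
def BQ2Rel (𝕜 : Type*) [Field 𝕜] (q a b c : 𝕜) :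
    FreeAlgebra 𝕜 (Fin 2) → FreeAlgebra 𝕜 (Fin 2) → Prop := fun u v =>
  u = ι 𝕜 (1 : Fin 2) * ι 𝕜 (0 : Fin 2) ∧
    v = q • (ι 𝕜 (0 : Fin 2) * ι 𝕜 (1 : Fin 2)) + a • ι 𝕜 (0 : Fin 2) + b • ι 𝕜 (1 : Fin 2) +
      algebraMap 𝕜 (FreeAlgebra 𝕜 (Fin 2)) c

/-- The bi-quadratic algebra on two generators `𝕜[x₁,x₂;q,a,b,c]`. -/
abbrev BQ2 (𝕜 : Type*) [Field 𝕜] (q a b c : 𝕜) : Type _ :=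
  RingQuot (BQ2Rel 𝕜 q a b c)

/-- The images of the two generators. -/
def BQ2x (𝕜 : Type*) [Field 𝕜] (q a b c : 𝕜) (i : Fin 2) : BQ2 𝕜 q a b c :=
  RingQuot.mkAlgHom 𝕜 (BQ2Rel 𝕜 q a b c) (ι 𝕜 i)

namespace BQ2

variable {𝕜 : Type*} [Field 𝕜] {q a b c : 𝕜}

theorem relation (q a b c : 𝕜) :
    BQ2x 𝕜 q a b c 1 * BQ2x 𝕜 q a b c 0 =
      q • (BQ2x 𝕜 q a b c 0 * BQ2x 𝕜 q a b c 1) + a • BQ2x 𝕜 q a b c 0 +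
        b • BQ2x 𝕜 q a b c 1 + c • (1 : BQ2 𝕜 q a b c) := by
  have h := RingQuot.mkAlgHom_rel 𝕜 (s := BQ2Rel 𝕜 q a b c) ⟨rfl, rfl⟩
  simp only [map_add, map_mul, map_smul, Algebra.algebraMap_eq_smul_one,
    map_one] at h
  exact h

/-- The algebra homomorphism determined by two elements satisfying the defining relation. -/
def lift {A : Type*} [Ring A] [Algebra 𝕜 A] (u v : A)
    (h : v * u = q • (u * v) + a • u + b • v + c • (1 : A)) : BQ2 𝕜 q a b c →ₐ[𝕜] A :=
  RingQuot.liftAlgHom 𝕜 ⟨FreeAlgebra.lift 𝕜 ![u, v], by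
    rintro _ _ ⟨rfl, rfl⟩
    simpa [Algebra.algebraMap_eq_smul_one] using h⟩

section lift

variable {A : Type*} [Ring A] [Algebra 𝕜 A] {u v : A}
  (h : v * u = q • (u * v) + a • u + b • v + c • (1 : A))

@[simp]
theorem lift_zero : lift u v h (BQ2x 𝕜 q a b c 0) = u := by
  simp [lift, BQ2x]

@[simp]
theorem lift_one : lift u v h (BQ2x 𝕜 q a b c 1) = v := by
  simp [lift, BQ2x]

end lift

theorem algHom_ext {A : Type*} [Semiring A] [Algebra 𝕜 A] {f g : BQ2 𝕜 q a b c →ₐ[𝕜] A}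
    (h0 : f (BQ2x 𝕜 q a b c 0) = g (BQ2x 𝕜 q a b c 0))
    (h1 : f (BQ2x 𝕜 q a b c 1) = g (BQ2x 𝕜 q a b c 1)) : f = g := by
  apply RingQuot.ringQuot_ext'
  apply FreeAlgebra.hom_ext
  funext i
  fin_cases i
  · exact h0
  · exact h1

/-- Translating the generators. -/
theorem nonempty_equiv_translate (q a b c s t : 𝕜) :
    Nonempty (BQ2 𝕜 q a b c ≃ₐ[𝕜]
      BQ2 𝕜 q ((q - 1) * t + a) ((q - 1) * s + b) ((q - 1) * s * t + a * s + b * t + c)) := by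
  set a' := (q - 1) * t + a with ha
  set b' := (q - 1) * s + b with hb
  set c' := (q - 1) * s * t + a * s + b * t + c with hc
  refine ⟨AlgEquiv.ofAlgHom
    (lift (BQ2x 𝕜 q a' b' c' 0 + s • 1) (BQ2x 𝕜 q a' b' c' 1 + t • 1) ?_)
    (lift (BQ2x 𝕜 q a b c 0 - s • 1) (BQ2x 𝕜 q a b c 1 - t • 1) ?_)
    (algHom_ext ?_ ?_) (algHom_ext ?_ ?_)⟩
  · simp only [mul_add, add_mul, smul_mul_assoc, mul_smul_comm, mul_one, one_mul, relation]
    match_scalars <;> simp only [ha, hb, hc] <;> ring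
  · simp only [mul_sub, sub_mul, smul_mul_assoc, mul_smul_comm, mul_one, one_mul, relation]
    match_scalars <;> simp only [ha, hb, hc] <;> ring
  all_goals simp

/-- Rescaling the first generator. -/
theorem nonempty_equiv_scale (q c : 𝕜) {r : 𝕜} (hr : r ≠ 0) :
    Nonempty (BQ2 𝕜 q 0 0 (r * c) ≃ₐ[𝕜] BQ2 𝕜 q 0 0 c) := by
  refine ⟨AlgEquiv.ofAlgHom
    (lift (r • BQ2x 𝕜 q 0 0 c 0) (BQ2x 𝕜 q 0 0 c 1) ?_)
    (lift (r⁻¹ • BQ2x 𝕜 q 0 0 (r * c) 0) (BQ2x 𝕜 q 0 0 (r * c) 1) ?_)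
    (algHom_ext ?_ ?_) (algHom_ext ?_ ?_)⟩
  · simp only [smul_mul_assoc, mul_smul_comm, relation]
    match_scalars <;> ring
  · simp only [smul_mul_assoc, mul_smul_comm, relation]
    match_scalars <;> field_simp <;> ring
  all_goals simp [smul_smul, hr]

theorem nonempty_equiv_of_left_ne_zero (b c : 𝕜) {a : 𝕜} (ha : a ≠ 0) :
    Nonempty (BQ2 𝕜 1 a b c ≃ₐ[𝕜] BQ2 𝕜 1 1 0 0) := by
  refine ⟨AlgEquiv.ofAlgHom
    (lift (a⁻¹ • BQ2x 𝕜 1 1 0 0 0 - b • BQ2x 𝕜 1 1 0 0 1 - (a⁻¹ * c) • 1)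
      (a • BQ2x 𝕜 1 1 0 0 1) ?_)
    (lift (a • BQ2x 𝕜 1 a b c 0 + b • BQ2x 𝕜 1 a b c 1 + c • 1)
      (a⁻¹ • BQ2x 𝕜 1 a b c 1) ?_)
    (algHom_ext ?_ ?_) (algHom_ext ?_ ?_)⟩
  · simp only [mul_sub, sub_mul, smul_mul_assoc, mul_smul_comm, mul_one, one_mul, relation]
    match_scalars <;> field_simp <;> ring
  · simp only [mul_add, add_mul, smul_mul_assoc, mul_smul_comm, mul_one, one_mul, relation]
    match_scalars <;> field_simp <;> ring
  all_goals
    simp only [map_add, map_sub, map_smul, map_one, lift_zero, lift_one, AlgHom.comp_apply,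
      AlgHom.id_apply]
    match_scalars <;> field_simp <;> ring

theorem nonempty_equiv_of_right_ne_zero (c : 𝕜) {b : 𝕜} (hb : b ≠ 0) :
    Nonempty (BQ2 𝕜 1 0 b c ≃ₐ[𝕜] BQ2 𝕜 1 1 0 0) := by
  refine ⟨AlgEquiv.ofAlgHom
    (lift (-b • BQ2x 𝕜 1 1 0 0 1) (b⁻¹ • BQ2x 𝕜 1 1 0 0 0 - (b⁻¹ * c) • 1) ?_)
    (lift (b • BQ2x 𝕜 1 0 b c 1 + c • 1) (-b⁻¹ • BQ2x 𝕜 1 0 b c 0) ?_)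
    (algHom_ext ?_ ?_) (algHom_ext ?_ ?_)⟩
  · simp only [mul_sub, sub_mul, smul_mul_assoc, mul_smul_comm, mul_one, one_mul, relation]
    match_scalars <;> field_simp <;> ring
  · simp only [mul_add, add_mul, smul_mul_assoc, mul_smul_comm, mul_one, one_mul, relation]
    match_scalars <;> field_simp <;> ring
  all_goals
    simp only [map_add, map_sub, map_smul, map_one, lift_zero, lift_one, AlgHom.comp_apply,
      AlgHom.id_apply]
    match_scalars <;> field_simp <;> ring

theorem adjoin_generators (q a b c : 𝕜) :
    Algebra.adjoin 𝕜 (Set.range (BQ2x 𝕜 q a b c)) = ⊤ := by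
  have : Set.range (BQ2x 𝕜 q a b c) =
      RingQuot.mkAlgHom 𝕜 (BQ2Rel 𝕜 q a b c) '' Set.range (ι 𝕜) := by
    rw [← Set.range_comp]; rfl
  rw [this, ← AlgHom.map_adjoin, FreeAlgebra.adjoin_range_ι, Algebra.map_top,
    AlgHom.range_eq_top]
  exact RingQuot.mkAlgHom_surjective 𝕜 _

theorem mul_comm_of_one_zero (x y : BQ2 𝕜 1 0 0 0) : x * y = y * x := by
  have h : BQ2x 𝕜 1 0 0 0 1 * BQ2x 𝕜 1 0 0 0 0 = BQ2x 𝕜 1 0 0 0 0 * BQ2x 𝕜 1 0 0 0 1 := by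
    simpa using relation (1 : 𝕜) 0 0 0
  have key := Algebra.adjoin_le_centralizer_centralizer 𝕜 (Set.range (BQ2x 𝕜 1 0 0 0))
  rw [adjoin_generators] at key
  have hgen : ∀ i, BQ2x 𝕜 1 0 0 0 i ∈ Subalgebra.centralizer 𝕜 (Set.range (BQ2x 𝕜 1 0 0 0)) := by
    intro i
    rw [Subalgebra.mem_centralizer_iff]
    rintro _ ⟨j, rfl⟩
    fin_cases i <;> fin_cases j <;> first | rfl | exact h | exact h.symm
  have htop : (⊤ : Subalgebra 𝕜 (BQ2 𝕜 1 0 0 0)) ≤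
      Subalgebra.centralizer 𝕜 (Set.range (BQ2x 𝕜 1 0 0 0)) := by
    rw [← adjoin_generators, Algebra.adjoin_le_iff]
    rintro _ ⟨i, rfl⟩
    exact hgen i
  have hx := key (Algebra.mem_top (x := x))
  rw [Subalgebra.mem_centralizer_iff] at hx
  exact (hx y (htop Algebra.mem_top)).symm

theorem nonempty_equiv_mvPolynomial (𝕜 : Type*) [Field 𝕜] :
    Nonempty (BQ2 𝕜 1 0 0 0 ≃ₐ[𝕜] MvPolynomial (Fin 2) 𝕜) := by
  let : CommRing (BQ2 𝕜 1 0 0 0) :=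
    { (inferInstance : Ring (BQ2 𝕜 1 0 0 0)) with mul_comm := mul_comm_of_one_zero }
  refine ⟨AlgEquiv.ofAlgHom
    (lift (MvPolynomial.X 0) (MvPolynomial.X 1) (by simp [mul_comm]))
    (MvPolynomial.aeval (BQ2x 𝕜 1 0 0 0))
    (MvPolynomial.algHom_ext fun i => ?_) (algHom_ext ?_ ?_)⟩
  · fin_cases i <;> simp
  all_goals simp

end BQ2

/-- Up to isomorphism there are only five bi-quadratic algebras on two generators: the polynomial
algebra, the Weyl algebra, `U(𝔫₂)`, a quantum plane, or a quantum Weyl algebra. -/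
theorem biquadratic2_classification (𝕜 : Type*) [Field 𝕜] (q a b c : 𝕜) (hq : q ≠ 0) :
    Nonempty (BQ2 𝕜 q a b c ≃ₐ[𝕜] MvPolynomial (Fin 2) 𝕜) ∨
    Nonempty (BQ2 𝕜 q a b c ≃ₐ[𝕜] BQ2 𝕜 1 0 0 (-1)) ∨
    Nonempty (BQ2 𝕜 q a b c ≃ₐ[𝕜] BQ2 𝕜 1 1 0 0) ∨
    (∃ q' : 𝕜, q' ≠ 0 ∧ q' ≠ 1 ∧ Nonempty (BQ2 𝕜 q a b c ≃ₐ[𝕜] BQ2 𝕜 q' 0 0 0)) ∨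
    (∃ q' : 𝕜, q' ≠ 0 ∧ q' ≠ 1 ∧ Nonempty (BQ2 𝕜 q a b c ≃ₐ[𝕜] BQ2 𝕜 q' 0 0 1)) := by
  by_cases hq1 : q = 1
  · subst hq1
    by_cases ha : a = 0
    · subst ha
      by_cases hb : b = 0
      · subst hb
        by_cases hc : c = 0
        · subst hc
          exact .inl (BQ2.nonempty_equiv_mvPolynomial 𝕜)
        · have h := BQ2.nonempty_equiv_scale (1 : 𝕜) (-1) (neg_ne_zero.mpr hc)
          rw [neg_mul_neg, mul_one] at h
          exact .inr (.inl h)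
      · exact .inr (.inr (.inl (BQ2.nonempty_equiv_of_right_ne_zero c hb)))
    · exact .inr (.inr (.inl (BQ2.nonempty_equiv_of_left_ne_zero b c ha)))
  · have hq' : q - 1 ≠ 0 := sub_ne_zero.mpr hq1
    obtain ⟨c', ⟨e⟩⟩ : ∃ c', Nonempty (BQ2 𝕜 q a b c ≃ₐ[𝕜] BQ2 𝕜 q 0 0 c') := by
      have h := BQ2.nonempty_equiv_translate q a b c (-b / (q - 1)) (-a / (q - 1))
      rw [mul_div_cancel₀ _ hq', mul_div_cancel₀ _ hq', neg_add_cancel, neg_add_cancel] at h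
      exact ⟨_, h⟩
    by_cases hc : c' = 0
    · subst hc
      exact .inr (.inr (.inr (.inl ⟨q, hq, hq1, ⟨e⟩⟩)))
    · obtain ⟨f⟩ := BQ2.nonempty_equiv_scale q 1 hc
      rw [mul_one] at f
      exact .inr (.inr (.inr (.inr ⟨q, hq, hq1, ⟨e.trans f⟩⟩)))
end
end

section
/- Let A be the bi-quadratic algebra on three generators over a field 𝕜 with parameters q₁,q₂,q₃ ∈ 𝕜 nonzero and a,b,c,α,β,γ,λ,μ,ν,b₁,b₂,b₃ ∈ 𝕜. Assume c = β = λ = 0 and that the images of the monomials x₁^{a₁}x₂^{a₂}x₃^{a₃}, (a₁,a₂,a₃) ∈ ℕ³, form a basis of A as a 𝕜-vector space. Then there exists a 𝕜-algebra endomorphism ν₂ of A with ν₂(x₁) = q₁⁻¹x₁ − bq₁⁻¹, ν₂(x₂) = x₂ and ν₂(x₃) = q₃x₃ + μ if and only if the following equations hold: b₁(q₁−1) − ab = 0; μ(q₂−1) = α(q₃−1); b(q₂−1) = γ(q₁−1); b₂(q₁−q₃) + q₁γμ + b(μ − q₂μ − α) = 0; b₃(q₃−1) − νμ = 0. -/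
noncomputable section

open FreeAlgebra

section GenericRelations

variable {𝕜 A : Type*} [Field 𝕜] [Ring A] [Algebra 𝕜 A]

/-- The defect of the relation between `x` and `y` after substituting `q⁻¹(x - b)` for `x`. -/
theorem first_relation_defect {q a b b₁ : 𝕜} (hq : q ≠ 0) {x y : A}
    (h : y * x = q • (x * y) + a • x + b • y + algebraMap 𝕜 A b₁) :
    y * (q⁻¹ • x - algebraMap 𝕜 A (b * q⁻¹)) -
      (q • ((q⁻¹ • x - algebraMap 𝕜 A (b * q⁻¹)) * y) +
        a • (q⁻¹ • x - algebraMap 𝕜 A (b * q⁻¹)) + b • y + algebraMap 𝕜 A b₁) =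
    algebraMap 𝕜 A (-q⁻¹ * (b₁ * (q - 1) - a * b)) := by
  simp only [Algebra.algebraMap_eq_smul_one, mul_sub, sub_mul, mul_smul_comm, smul_mul_assoc,
    mul_one, one_mul] at h ⊢
  rw [h]
  match_scalars <;> field_simp <;> ring

/-- The defect of the relation between `x` and `z` after substituting `q₁⁻¹(x - b)` for `x`
and `q₃ z + μ` for `z`. -/
theorem second_relation_defect {q₁ q₂ q₃ b α γ μ b₂ : 𝕜} (hq₁ : q₁ ≠ 0) {x z : A}
    (h : z * x = q₂ • (x * z) + α • x + γ • z + algebraMap 𝕜 A b₂) :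
    (q₃ • z + algebraMap 𝕜 A μ) * (q₁⁻¹ • x - algebraMap 𝕜 A (b * q₁⁻¹)) -
      (q₂ • ((q₁⁻¹ • x - algebraMap 𝕜 A (b * q₁⁻¹)) * (q₃ • z + algebraMap 𝕜 A μ)) +
        α • (q₁⁻¹ • x - algebraMap 𝕜 A (b * q₁⁻¹)) + γ • (q₃ • z + algebraMap 𝕜 A μ) +
        algebraMap 𝕜 A b₂) =
    (q₁⁻¹ * (α * (q₃ - 1) - μ * (q₂ - 1))) • x +
      (q₁⁻¹ * q₃ * (b * (q₂ - 1) - γ * (q₁ - 1))) • z +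
      algebraMap 𝕜 A
        (-q₁⁻¹ * (b₂ * (q₁ - q₃) + q₁ * γ * μ + b * (μ - q₂ * μ - α))) := by
  simp only [Algebra.algebraMap_eq_smul_one, mul_sub, sub_mul, mul_add, add_mul, mul_smul_comm,
    smul_mul_assoc, mul_one, one_mul] at h ⊢
  rw [h]
  match_scalars <;> field_simp <;> ring

/-- The defect of the relation between `y` and `z` after substituting `q z + μ` for `z`. -/
theorem third_relation_defect {q μ ν b₃ : 𝕜} {y z : A}
    (h : z * y = q • (y * z) + μ • y + ν • z + algebraMap 𝕜 A b₃) :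
    (q • z + algebraMap 𝕜 A μ) * y -
      (q • (y * (q • z + algebraMap 𝕜 A μ)) + μ • y + ν • (q • z + algebraMap 𝕜 A μ) +
        algebraMap 𝕜 A b₃) =
    algebraMap 𝕜 A (b₃ * (q - 1) - ν * μ) := by
  simp only [Algebra.algebraMap_eq_smul_one, mul_add, add_mul, mul_smul_comm, smul_mul_assoc,
    mul_one, one_mul] at h ⊢
  rw [h]
  match_scalars <;> ring

/-- If the ordered monomials are linearly independent, so are `x`, `z` and `1`. -/
theorem coeffs_eq_zero_of_linearIndependent_monomials {x y z : A}
    (h : LinearIndependent 𝕜 (fun m : ℕ × ℕ × ℕ => x ^ m.1 * y ^ m.2.1 * z ^ m.2.2))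
    {r s t : 𝕜} (h0 : r • x + s • z + algebraMap 𝕜 A t = 0) : r = 0 ∧ s = 0 ∧ t = 0 := by
  have hinj : Function.Injective ![((1 : ℕ), (0 : ℕ), (0 : ℕ)), (0, 0, 1), (0, 0, 0)] := by
    decide
  have hli := Fintype.linearIndependent_iff.1 (h.comp _ hinj) ![r, s, t]
    (by simpa [Fin.sum_univ_three, Algebra.algebraMap_eq_smul_one] using h0)
  exact ⟨hli 0, hli 1, hli 2⟩

end GenericRelations

section Presentation

variable {𝕜 : Type*} [Field 𝕜] {q₁ q₂ q₃ a b c α β γ lam μ ν b₁ b₂ b₃ : 𝕜}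

local notation "X" => BQ3x 𝕜 q₁ q₂ q₃ a b c α β γ lam μ ν b₁ b₂ b₃
local notation "B" => BQ3 𝕜 q₁ q₂ q₃ a b c α β γ lam μ ν b₁ b₂ b₃

theorem BQ3x_relations :
    X 1 * X 0 = q₁ • (X 0 * X 1) + a • X 0 + b • X 1 + c • X 2 + algebraMap 𝕜 B b₁ ∧
    X 2 * X 0 = q₂ • (X 0 * X 2) + α • X 0 + β • X 1 + γ • X 2 + algebraMap 𝕜 B b₂ ∧
    X 2 * X 1 = q₃ • (X 1 * X 2) + lam • X 0 + μ • X 1 + ν • X 2 + algebraMap 𝕜 B b₃ := by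
  refine ⟨?_, ?_, ?_⟩
  · simpa [BQ3x] using RingQuot.mkAlgHom_rel 𝕜
      (s := BQ3Rel 𝕜 q₁ q₂ q₃ a b c α β γ lam μ ν b₁ b₂ b₃) (Or.inl ⟨rfl, rfl⟩)
  · simpa [BQ3x] using RingQuot.mkAlgHom_rel 𝕜
      (s := BQ3Rel 𝕜 q₁ q₂ q₃ a b c α β γ lam μ ν b₁ b₂ b₃) (Or.inr (Or.inl ⟨rfl, rfl⟩))
  · simpa [BQ3x] using RingQuot.mkAlgHom_rel 𝕜
      (s := BQ3Rel 𝕜 q₁ q₂ q₃ a b c α β γ lam μ ν b₁ b₂ b₃) (Or.inr (Or.inr ⟨rfl, rfl⟩))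

/-- The universal property of the bi-quadratic algebra: an algebra homomorphism with prescribed
values on the generators exists if and only if these values satisfy the defining relations. -/
theorem BQ3_exists_algHom_iff {A : Type*} [Ring A] [Algebra 𝕜 A] (x y z : A) :
    (∃ f : B →ₐ[𝕜] A, f (X 0) = x ∧ f (X 1) = y ∧ f (X 2) = z) ↔
    (y * x = q₁ • (x * y) + a • x + b • y + c • z + algebraMap 𝕜 A b₁ ∧
      z * x = q₂ • (x * z) + α • x + β • y + γ • z + algebraMap 𝕜 A b₂ ∧
      z * y = q₃ • (y * z) + lam • x + μ • y + ν • z + algebraMap 𝕜 A b₃) := by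
  constructor
  · rintro ⟨f, rfl, rfl, rfl⟩
    obtain ⟨h₁, h₂, h₃⟩ := BQ3x_relations (q₁ := q₁) (q₂ := q₂) (q₃ := q₃) (a := a) (b := b)
      (c := c) (α := α) (β := β) (γ := γ) (lam := lam) (μ := μ) (ν := ν) (b₁ := b₁) (b₂ := b₂)
      (b₃ := b₃)
    refine ⟨?_, ?_, ?_⟩
    · simpa only [map_mul, map_add, map_smul, AlgHom.commutes] using congrArg f h₁
    · simpa only [map_mul, map_add, map_smul, AlgHom.commutes] using congrArg f h₂
    · simpa only [map_mul, map_add, map_smul, AlgHom.commutes] using congrArg f h₃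
  · rintro ⟨h₁, h₂, h₃⟩
    refine ⟨RingQuot.liftAlgHom 𝕜 ⟨FreeAlgebra.lift 𝕜 ![x, y, z], ?_⟩, ?_, ?_, ?_⟩
    · rintro u v (⟨rfl, rfl⟩ | ⟨rfl, rfl⟩ | ⟨rfl, rfl⟩)
      · simpa using h₁
      · simpa using h₂
      · simpa using h₃
    all_goals simp [BQ3x]

end Presentation

/-- Existence of the algebra endomorphism `nu₂` of the bi-quadratic algebra on three
generators with the prescribed values on the generators is equivalent to the stated equations. -/
theorem biquadratic_endo_5 (𝕜 : Type*) [Field 𝕜] (q₁ q₂ q₃ a b c α β γ lam μ ν b₁ b₂ b₃ : 𝕜)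
    (hq₁ : q₁ ≠ 0) (hq₂ : q₂ ≠ 0) (hq₃ : q₃ ≠ 0)
    (hc : c = 0) (hβ : β = 0) (hlam : lam = 0)
    (hpbw : LinearIndependent 𝕜 (fun m : ℕ × ℕ × ℕ =>
        BQ3x 𝕜 q₁ q₂ q₃ a b c α β γ lam μ ν b₁ b₂ b₃ 0 ^ m.1 *
        BQ3x 𝕜 q₁ q₂ q₃ a b c α β γ lam μ ν b₁ b₂ b₃ 1 ^ m.2.1 *
        BQ3x 𝕜 q₁ q₂ q₃ a b c α β γ lam μ ν b₁ b₂ b₃ 2 ^ m.2.2) ∧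
      Submodule.span 𝕜 (Set.range (fun m : ℕ × ℕ × ℕ =>
        BQ3x 𝕜 q₁ q₂ q₃ a b c α β γ lam μ ν b₁ b₂ b₃ 0 ^ m.1 *
        BQ3x 𝕜 q₁ q₂ q₃ a b c α β γ lam μ ν b₁ b₂ b₃ 1 ^ m.2.1 *
        BQ3x 𝕜 q₁ q₂ q₃ a b c α β γ lam μ ν b₁ b₂ b₃ 2 ^ m.2.2)) = ⊤) :
    (∃ f : BQ3 𝕜 q₁ q₂ q₃ a b c α β γ lam μ ν b₁ b₂ b₃ →ₐ[𝕜] BQ3 𝕜 q₁ q₂ q₃ a b c α β γ lam μ ν b₁ b₂ b₃,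
      f (BQ3x 𝕜 q₁ q₂ q₃ a b c α β γ lam μ ν b₁ b₂ b₃ 0) = q₁⁻¹ • BQ3x 𝕜 q₁ q₂ q₃ a b c α β γ lam μ ν b₁ b₂ b₃ 0 - algebraMap 𝕜 (BQ3 𝕜 q₁ q₂ q₃ a b c α β γ lam μ ν b₁ b₂ b₃) (b * q₁⁻¹) ∧
      f (BQ3x 𝕜 q₁ q₂ q₃ a b c α β γ lam μ ν b₁ b₂ b₃ 1) = BQ3x 𝕜 q₁ q₂ q₃ a b c α β γ lam μ ν b₁ b₂ b₃ 1 ∧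
      f (BQ3x 𝕜 q₁ q₂ q₃ a b c α β γ lam μ ν b₁ b₂ b₃ 2) = q₃ • BQ3x 𝕜 q₁ q₂ q₃ a b c α β γ lam μ ν b₁ b₂ b₃ 2 + algebraMap 𝕜 (BQ3 𝕜 q₁ q₂ q₃ a b c α β γ lam μ ν b₁ b₂ b₃) μ) ↔
    (b₁ * (q₁ - 1) - a * b = 0 ∧
      μ * (q₂ - 1) = α * (q₃ - 1) ∧
      b * (q₂ - 1) = γ * (q₁ - 1) ∧
      b₂ * (q₁ - q₃) + q₁ * γ * μ + b * (μ - q₂ * μ - α) = 0 ∧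
      b₃ * (q₃ - 1) - ν * μ = 0) := by
  obtain ⟨hli, -⟩ := hpbw
  obtain ⟨r₁, r₂, r₃⟩ := BQ3x_relations (q₁ := q₁) (q₂ := q₂) (q₃ := q₃) (a := a) (b := b)
    (c := c) (α := α) (β := β) (γ := γ) (lam := lam) (μ := μ) (ν := ν) (b₁ := b₁) (b₂ := b₂)
    (b₃ := b₃)
  subst hc hβ hlam
  rw [BQ3_exists_algHom_iff]
  simp only [zero_smul, add_zero] at r₁ r₂ r₃ ⊢
  rw [← sub_eq_zero, first_relation_defect hq₁ r₁]
  nth_rewrite 2 [← sub_eq_zero]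
  rw [second_relation_defect hq₁ r₂]
  nth_rewrite 3 [← sub_eq_zero]
  rw [third_relation_defect r₃]
  have hscalar {t : 𝕜} (ht : algebraMap 𝕜 (BQ3 𝕜 q₁ q₂ q₃ a b 0 α 0 γ 0 μ ν b₁ b₂ b₃) t = 0) :
      t = 0 :=
    (coeffs_eq_zero_of_linearIndependent_monomials hli (r := 0) (s := 0) (by simpa using ht)).2.2
  constructor
  · rintro ⟨h₁, h₂, h₃⟩
    obtain ⟨hx, hz, h1⟩ := coeffs_eq_zero_of_linearIndependent_monomials hli h₂
    refine ⟨?_, ?_, ?_, ?_, hscalar h₃⟩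
    · simpa [hq₁] using hscalar h₁
    · exact (sub_eq_zero.1 (by simpa [hq₁] using hx)).symm
    · exact sub_eq_zero.1 (by simpa [hq₁, hq₃] using hz)
    · simpa [hq₁] using h1
  · rintro ⟨h₁, hx, hz, h1, h₃⟩
    simp [h₁, hx, hz, h1, h₃]
end
end

section
/- Let A be the bi-quadratic algebra on three generators over a field 𝕜 with parameters q₁,q₂,q₃ ∈ 𝕜 nonzero and a,b,c,α,β,γ,λ,μ,ν,b₁,b₂,b₃ ∈ 𝕜. Assume Bavula's consistency conditions hold and moreover c = β = λ = 0, b₁(q₁−1) − ab = 0, b₂(q₂−1) − αγ = 0, b₃(q₃−1) − μν = 0 and μa = 0. Then there exist 𝕜-algebra automorphisms ν₁, ν₂, ν₃ of A (i.e., bijective 𝕜-algebra endomorphisms) satisfying ν₁(x₁) = x₁, ν₁(x₂) = q₁x₂ + a, ν₁(x₃) = q₂x₃ + α; ν₂(x₁) = q₁⁻¹x₁ − bq₁⁻¹, ν₂(x₂) = x₂, ν₂(x₃) = q₃x₃ + μ; and ν₃(x₁) = q₂⁻¹x₁ − γq₂⁻¹, ν₃(x₂) = q₃⁻¹x₂ −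 νq₃⁻¹, ν₃(x₃) = x₃. -/
noncomputable section

open FreeAlgebra

/-- The affine substitution `x ↦ s₀x + t₀`, `y ↦ s₁y + t₁` is compatible with the relation
`yx = qxy + ax + by + k`: it multiplies `yx - qxy - ax - by - k` by `s₀s₁`. -/
structure AffineCompat {R : Type*} [CommRing R] (q a b k s₀ t₀ s₁ t₁ : R) : Prop where
  left : s₁ * a + (1 - q) * t₁ = a
  right : s₀ * b + (1 - q) * t₀ = b
  const : s₀ * s₁ * k + (1 - q) * (t₀ * t₁) - a * t₀ - b * t₁ = k

theorem AffineCompat.map_relation {R B : Type*} [CommRing R] [Ring B] [Algebra R B]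
    {q a b k s₀ t₀ s₁ t₁ : R} (h : AffineCompat q a b k s₀ t₀ s₁ t₁) {x y : B}
    (hxy : y * x = q • (x * y) + a • x + b • y + algebraMap R B k) :
    (s₁ • y + algebraMap R B t₁) * (s₀ • x + algebraMap R B t₀) =
      q • ((s₀ • x + algebraMap R B t₀) * (s₁ • y + algebraMap R B t₁)) +
        a • (s₀ • x + algebraMap R B t₀) + b • (s₁ • y + algebraMap R B t₁) +
        algebraMap R B k := by
  obtain ⟨h₁, h₂, h₃⟩ := h
  simp only [Algebra.algebraMap_eq_smul_one] at *
  simp only [mul_add, add_mul, smul_mul_assoc, mul_smul_comm, one_mul, mul_one, hxy]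
  linear_combination (norm := module) (s₀ * h₁) • x + (s₁ * h₂) • y + h₃ • (1 : B)

theorem AffineCompat.inv {F : Type*} [Field F] {q a b k s₀ t₀ s₁ t₁ : F}
    (h : AffineCompat q a b k s₀ t₀ s₁ t₁) (h₀ : s₀ ≠ 0) (h₁ : s₁ ≠ 0) :
    AffineCompat q a b k s₀⁻¹ (-(s₀⁻¹ * t₀)) s₁⁻¹ (-(s₁⁻¹ * t₁)) := by
  obtain ⟨hl, hr, hk⟩ := h
  refine ⟨?_, ?_, ?_⟩ <;> field_simp
  · linear_combination -hl
  · linear_combination -hr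
  · linear_combination -hk + t₀ * hl + t₁ * hr

section Affine

variable {𝕜 : Type*} [Field 𝕜] {q₁ q₂ q₃ a b α γ μ ν b₁ b₂ b₃ : 𝕜}

local notation "X" => BQ3x 𝕜 q₁ q₂ q₃ a b 0 α 0 γ 0 μ ν b₁ b₂ b₃
local notation "A" => BQ3 𝕜 q₁ q₂ q₃ a b 0 α 0 γ 0 μ ν b₁ b₂ b₃

theorem BQ3x_one_mul_zero :
    X 1 * X 0 = q₁ • (X 0 * X 1) + a • X 0 + b • X 1 + algebraMap 𝕜 A b₁ := by
  simpa [BQ3x] using RingQuot.mkAlgHom_rel 𝕜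
    (s := BQ3Rel 𝕜 q₁ q₂ q₃ a b 0 α 0 γ 0 μ ν b₁ b₂ b₃) (Or.inl ⟨rfl, rfl⟩)

theorem BQ3x_two_mul_zero :
    X 2 * X 0 = q₂ • (X 0 * X 2) + α • X 0 + γ • X 2 + algebraMap 𝕜 A b₂ := by
  simpa [BQ3x] using RingQuot.mkAlgHom_rel 𝕜
    (s := BQ3Rel 𝕜 q₁ q₂ q₃ a b 0 α 0 γ 0 μ ν b₁ b₂ b₃) (Or.inr (Or.inl ⟨rfl, rfl⟩))

theorem BQ3x_two_mul_one :
    X 2 * X 1 = q₃ • (X 1 * X 2) + μ • X 1 + ν • X 2 + algebraMap 𝕜 A b₃ := by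
  simpa [BQ3x] using RingQuot.mkAlgHom_rel 𝕜
    (s := BQ3Rel 𝕜 q₁ q₂ q₃ a b 0 α 0 γ 0 μ ν b₁ b₂ b₃) (Or.inr (Or.inr ⟨rfl, rfl⟩))

theorem BQ3_algHom_ext {B : Type*} [Semiring B] [Algebra 𝕜 B] {f g : A →ₐ[𝕜] B}
    (h : ∀ i, f (X i) = g (X i)) : f = g := by
  apply RingQuot.ringQuot_ext'
  apply FreeAlgebra.hom_ext
  funext i
  exact h i

theorem BQ3_exists_affine_algHom (s t : Fin 3 → 𝕜)
    (h₁ : AffineCompat q₁ a b b₁ (s 0) (t 0) (s 1) (t 1))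
    (h₂ : AffineCompat q₂ α γ b₂ (s 0) (t 0) (s 2) (t 2))
    (h₃ : AffineCompat q₃ μ ν b₃ (s 1) (t 1) (s 2) (t 2)) :
    ∃ f : A →ₐ[𝕜] A, ∀ i, f (X i) = s i • X i + algebraMap 𝕜 A (t i) := by
  refine ⟨RingQuot.liftAlgHom 𝕜
    ⟨FreeAlgebra.lift 𝕜 fun i => s i • X i + algebraMap 𝕜 A (t i), ?_⟩, fun i => ?_⟩
  · rintro u v (⟨rfl, rfl⟩ | ⟨rfl, rfl⟩ | ⟨rfl, rfl⟩)
    · simpa using h₁.map_relation BQ3x_one_mul_zero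
    · simpa using h₂.map_relation BQ3x_two_mul_zero
    · simpa using h₃.map_relation BQ3x_two_mul_one
  · exact (RingQuot.liftAlgHom_mkAlgHom_apply ..).trans (FreeAlgebra.lift_ι_apply ..)

theorem BQ3_exists_affine_algEquiv (s t : Fin 3 → 𝕜) (hs : ∀ i, s i ≠ 0)
    (h₁ : AffineCompat q₁ a b b₁ (s 0) (t 0) (s 1) (t 1))
    (h₂ : AffineCompat q₂ α γ b₂ (s 0) (t 0) (s 2) (t 2))
    (h₃ : AffineCompat q₃ μ ν b₃ (s 1) (t 1) (s 2) (t 2)) :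
    ∃ f : A ≃ₐ[𝕜] A, ∀ i, f (X i) = s i • X i + algebraMap 𝕜 A (t i) := by
  obtain ⟨f, hf⟩ := BQ3_exists_affine_algHom s t h₁ h₂ h₃
  obtain ⟨g, hg⟩ := BQ3_exists_affine_algHom (fun i => (s i)⁻¹) (fun i => -((s i)⁻¹ * t i))
    (h₁.inv (hs 0) (hs 1)) (h₂.inv (hs 0) (hs 2)) (h₃.inv (hs 1) (hs 2))
  refine ⟨AlgEquiv.ofAlgHom f g (BQ3_algHom_ext fun i => ?_) (BQ3_algHom_ext fun i => ?_), hf⟩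
  · simp [hf, hg, smul_smul, hs i, Algebra.algebraMap_eq_smul_one, add_assoc, ← add_smul]
  · simp [hf, hg, smul_smul, hs i, Algebra.algebraMap_eq_smul_one]

end Affine

/-- Under Bavula's consistency conditions together with `c = β = λ = 0`,
`b₁(q₁−1) − ab = 0`, `b₂(q₂−1) − αγ = 0`, `b₃(q₃−1) − μν = 0` and `μa = 0`, the three maps
`ν₁`, `ν₂`, `ν₃` extend to algebra automorphisms of the bi-quadratic algebra. -/
theorem biquadratic_automorphisms (𝕜 : Type*) [Field 𝕜] (q₁ q₂ q₃ a b c α β γ lam μ ν b₁ b₂ b₃ : 𝕜)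
    (hq₁ : q₁ ≠ 0) (hq₂ : q₂ ≠ 0) (hq₃ : q₃ ≠ 0)
    (hB1 : (1 - q₃) * α = (1 - q₂) * μ)
    (hB2 : (1 - q₃) * a = (1 - q₁) * ν)
    (hB3 : (1 - q₂) * b = (1 - q₁) * γ)
    (hB4 : (1 - q₁ * q₂) * lam = 0)
    (hB5 : (q₁ - q₃) * β = 0)
    (hB6 : (1 - q₂ * q₃) * c = 0)
    (hB7 : ((1 - q₃) * α - μ) * a + (b + q₁ * γ) * lam - ν * α + (q₁ * q₂ - 1) * b₃ = 0)
    (hB8 : (a - ν) * β + q₁ * γ * μ - q₃ * α * b + (q₁ - q₃) * b₂ = 0)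
    (hB9 : (a + (q₁ - 1) * ν) * γ + b * ν - (μ + q₃ * α) * c + (1 - q₂ * q₃) * b₁ = 0)
    (hB10 : -(μ + q₃ * α) * b₁ + (a - ν) * b₂ + (b + q₁ * γ) * b₃ = 0)
    (hc : c = 0) (hβ : β = 0) (hlam : lam = 0)
    (hE1 : b₁ * (q₁ - 1) - a * b = 0)
    (hE2 : b₂ * (q₂ - 1) - α * γ = 0)
    (hE3 : b₃ * (q₃ - 1) - μ * ν = 0)
    (hE4 : μ * a = 0) :
    ∃ (f₁ f₂ f₃ : BQ3 𝕜 q₁ q₂ q₃ a b c α β γ lam μ ν b₁ b₂ b₃ ≃ₐ[𝕜] BQ3 𝕜 q₁ q₂ q₃ a b c α β γ lam μ ν b₁ b₂ b₃),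
      (f₁ (BQ3x 𝕜 q₁ q₂ q₃ a b c α β γ lam μ ν b₁ b₂ b₃ 0) = BQ3x 𝕜 q₁ q₂ q₃ a b c α β γ lam μ ν b₁ b₂ b₃ 0 ∧
      f₁ (BQ3x 𝕜 q₁ q₂ q₃ a b c α β γ lam μ ν b₁ b₂ b₃ 1) = q₁ • BQ3x 𝕜 q₁ q₂ q₃ a b c α β γ lam μ ν b₁ b₂ b₃ 1 + algebraMap 𝕜 (BQ3 𝕜 q₁ q₂ q₃ a b c α β γ lam μ ν b₁ b₂ b₃) a ∧
      f₁ (BQ3x 𝕜 q₁ q₂ q₃ a b c α β γ lam μ ν b₁ b₂ b₃ 2) = q₂ • BQ3x 𝕜 q₁ q₂ q₃ a b c α β γ lam μ ν b₁ b₂ b₃ 2 + algebraMap 𝕜 (BQ3 𝕜 q₁ q₂ q₃ a b c α β γ lam μ ν b₁ b₂ b₃) α) ∧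
      (f₂ (BQ3x 𝕜 q₁ q₂ q₃ a b c α β γ lam μ ν b₁ b₂ b₃ 0) = q₁⁻¹ • BQ3x 𝕜 q₁ q₂ q₃ a b c α β γ lam μ ν b₁ b₂ b₃ 0 - algebraMap 𝕜 (BQ3 𝕜 q₁ q₂ q₃ a b c α β γ lam μ ν b₁ b₂ b₃) (b * q₁⁻¹) ∧
      f₂ (BQ3x 𝕜 q₁ q₂ q₃ a b c α β γ lam μ ν b₁ b₂ b₃ 1) = BQ3x 𝕜 q₁ q₂ q₃ a b c α β γ lam μ ν b₁ b₂ b₃ 1 ∧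
      f₂ (BQ3x 𝕜 q₁ q₂ q₃ a b c α β γ lam μ ν b₁ b₂ b₃ 2) = q₃ • BQ3x 𝕜 q₁ q₂ q₃ a b c α β γ lam μ ν b₁ b₂ b₃ 2 + algebraMap 𝕜 (BQ3 𝕜 q₁ q₂ q₃ a b c α β γ lam μ ν b₁ b₂ b₃) μ) ∧
      (f₃ (BQ3x 𝕜 q₁ q₂ q₃ a b c α β γ lam μ ν b₁ b₂ b₃ 0) = q₂⁻¹ • BQ3x 𝕜 q₁ q₂ q₃ a b c α β γ lam μ ν b₁ b₂ b₃ 0 - algebraMap 𝕜 (BQ3 𝕜 q₁ q₂ q₃ a b c α β γ lam μ ν b₁ b₂ b₃) (γ * q₂⁻¹) ∧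
      f₃ (BQ3x 𝕜 q₁ q₂ q₃ a b c α β γ lam μ ν b₁ b₂ b₃ 1) = q₃⁻¹ • BQ3x 𝕜 q₁ q₂ q₃ a b c α β γ lam μ ν b₁ b₂ b₃ 1 - algebraMap 𝕜 (BQ3 𝕜 q₁ q₂ q₃ a b c α β γ lam μ ν b₁ b₂ b₃) (ν * q₃⁻¹) ∧
      f₃ (BQ3x 𝕜 q₁ q₂ q₃ a b c α β γ lam μ ν b₁ b₂ b₃ 2) = BQ3x 𝕜 q₁ q₂ q₃ a b c α β γ lam μ ν b₁ b₂ b₃ 2) := by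
  subst hc hβ hlam
  obtain ⟨f₁, hf₁⟩ := BQ3_exists_affine_algEquiv (q₁ := q₁) (q₂ := q₂) (q₃ := q₃) (a := a)
    (b := b) (α := α) (γ := γ) (μ := μ) (ν := ν) (b₁ := b₁) (b₂ := b₂) (b₃ := b₃)
    ![1, q₁, q₂] ![0, a, α] (by simp [Fin.forall_fin_succ, hq₁, hq₂])
    ⟨by simp; ring, by simp, by simp; linear_combination hE1⟩
    ⟨by simp; ring, by simp, by simp; linear_combination hE2⟩
    ⟨by simp; linear_combination hB1, by simp; linear_combination hB2,
      by simp; linear_combination hB7⟩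
  obtain ⟨f₂, hf₂⟩ := BQ3_exists_affine_algEquiv (q₁ := q₁) (q₂ := q₂) (q₃ := q₃) (a := a)
    (b := b) (α := α) (γ := γ) (μ := μ) (ν := ν) (b₁ := b₁) (b₂ := b₂) (b₃ := b₃)
    ![q₁⁻¹, 1, q₃] ![-(b * q₁⁻¹), 0, μ] (by simp [Fin.forall_fin_succ, hq₁, hq₃])
    ⟨by simp, by simp; field_simp; ring, by simp; field_simp; linear_combination -hE1⟩
    ⟨by simp; linear_combination -hB1, by simp; field_simp; linear_combination -hB3,
      by simp; field_simp; linear_combination -hB8 + b * hB1⟩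
    ⟨by simp; ring, by simp, by simp; linear_combination hE3⟩
  obtain ⟨f₃, hf₃⟩ := BQ3_exists_affine_algEquiv (q₁ := q₁) (q₂ := q₂) (q₃ := q₃) (a := a)
    (b := b) (α := α) (γ := γ) (μ := μ) (ν := ν) (b₁ := b₁) (b₂ := b₂) (b₃ := b₃)
    ![q₂⁻¹, q₃⁻¹, 1] ![-(γ * q₂⁻¹), -(ν * q₃⁻¹), 0] (by simp [Fin.forall_fin_succ, hq₂, hq₃])
    ⟨by simp; field_simp; linear_combination hB2, by simp; field_simp; linear_combination hB3,
      by simp; field_simp; linear_combination hB9 - γ * hB2 - ν * hB3⟩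
    ⟨by simp, by simp; field_simp; ring, by simp; field_simp; linear_combination -hE2⟩
    ⟨by simp, by simp; field_simp; ring, by simp; field_simp; linear_combination -hE3⟩
  refine ⟨f₁, f₂, f₃, ⟨?_, hf₁ 1, hf₁ 2⟩, ⟨?_, ?_, hf₂ 2⟩, ?_, ?_, ?_⟩
  · simpa using hf₁ 0
  · simpa [sub_eq_add_neg] using hf₂ 0
  · simpa using hf₂ 1
  · simpa [sub_eq_add_neg] using hf₃ 0
  · simpa [sub_eq_add_neg] using hf₃ 1
  · simpa using hf₃ 2
end
end

section
/- Let A be the bi-quadratic algebra on three generators over a field 𝕜 with parameters q₁,q₂,q₃ ∈ 𝕜 nonzero and a,b,c,α,β,γ,λ,μ,ν,b₁,b₂,b₃ ∈ 𝕜. Assume Bavula's consistency conditions hold and moreover c = β = λ = 0, b₁(q₁−1) − ab = 0, b₂(q₂−1) − αγ = 0, b₃(q₃−1) − μν = 0 and μa = 0. Let ν₁, ν₂, ν₃ be the 𝕜-algebra endomorphisms of A determined by ν₁(x₁) = x₁, ν₁(x₂) = q₁x₂ + a, ν₁(x₃) = q₂x₃ + α; ν₂(x₁) = q₁⁻¹x₁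 − bq₁⁻¹, ν₂(x₂) = x₂, ν₂(x₃) = q₃x₃ + μ; ν₃(x₁) = q₂⁻¹x₁ − γq₂⁻¹, ν₃(x₂) = q₃⁻¹x₂ − νq₃⁻¹, ν₃(x₃) = x₃. Then these endomorphisms pairwise commute: ν₁∘ν₂ = ν₂∘ν₁, ν₁∘ν₃ = ν₃∘ν₁ and ν₂∘ν₃ = ν₃∘ν₂. -/
noncomputable section

open FreeAlgebra

/-- Algebra homomorphisms out of the bi-quadratic algebra agree if they agree on the generators. -/
theorem BQ3.algHom_ext {𝕜 : Type*} [Field 𝕜] {q₁ q₂ q₃ a b c α β γ lam μ ν b₁ b₂ b₃ : 𝕜}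
    {B : Type*} [Semiring B] [Algebra 𝕜 B]
    {f g : BQ3 𝕜 q₁ q₂ q₃ a b c α β γ lam μ ν b₁ b₂ b₃ →ₐ[𝕜] B}
    (h : ∀ i, f (BQ3x 𝕜 q₁ q₂ q₃ a b c α β γ lam μ ν b₁ b₂ b₃ i) =
      g (BQ3x 𝕜 q₁ q₂ q₃ a b c α β γ lam μ ν b₁ b₂ b₃ i)) : f = g := by
  apply RingQuot.ringQuot_ext'
  apply FreeAlgebra.hom_ext
  funext i
  exact h i

/-- Two algebra endomorphisms acting affinely on `x` commute at `x` as soon as the two affine maps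
have the same constant term when composed in either order. -/
theorem AlgHom.apply_apply_comm_of_affine {R A : Type*} [CommRing R] [Ring A] [Algebra R A]
    {f g : A →ₐ[R] A} {x : A} {p r s t : R}
    (hf : f x = p • x + algebraMap R A r) (hg : g x = s • x + algebraMap R A t)
    (h : s * r + t = p * t + r) : f (g x) = g (f x) := by
  have h' := congrArg (algebraMap R A) h
  simp only [map_add, map_mul, ← Algebra.smul_def] at h'
  simp only [hf, hg, map_add, map_smul, AlgHom.commutes, smul_add, add_assoc, h',
    smul_comm s p x]

/-- Under Bavula's consistency conditions together with `c = β = λ = 0`,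
`b₁(q₁−1) − ab = 0`, `b₂(q₂−1) − αγ = 0`, `b₃(q₃−1) − μν = 0` and `μa = 0`, the endomorphisms
`ν₁`, `ν₂`, `ν₃` determined by the prescribed values on the generators pairwise commute. -/
theorem biquadratic_automorphisms_commute (𝕜 : Type*) [Field 𝕜] (q₁ q₂ q₃ a b c α β γ lam μ ν b₁ b₂ b₃ : 𝕜)
    (hq₁ : q₁ ≠ 0) (hq₂ : q₂ ≠ 0) (hq₃ : q₃ ≠ 0)
    (hB1 : (1 - q₃) * α = (1 - q₂) * μ)
    (hB2 : (1 - q₃) * a = (1 - q₁) * ν)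
    (hB3 : (1 - q₂) * b = (1 - q₁) * γ)
    (hB4 : (1 - q₁ * q₂) * lam = 0)
    (hB5 : (q₁ - q₃) * β = 0)
    (hB6 : (1 - q₂ * q₃) * c = 0)
    (hB7 : ((1 - q₃) * α - μ) * a + (b + q₁ * γ) * lam - ν * α + (q₁ * q₂ - 1) * b₃ = 0)
    (hB8 : (a - ν) * β + q₁ * γ * μ - q₃ * α * b + (q₁ - q₃) * b₂ = 0)
    (hB9 : (a + (q₁ - 1) * ν) * γ + b * ν - (μ + q₃ * α) * c + (1 - q₂ * q₃) * b₁ = 0)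
    (hB10 : -(μ + q₃ * α) * b₁ + (a - ν) * b₂ + (b + q₁ * γ) * b₃ = 0)
    (hc : c = 0) (hβ : β = 0) (hlam : lam = 0)
    (hE1 : b₁ * (q₁ - 1) - a * b = 0)
    (hE2 : b₂ * (q₂ - 1) - α * γ = 0)
    (hE3 : b₃ * (q₃ - 1) - μ * ν = 0)
    (hE4 : μ * a = 0)
    (f₁ f₂ f₃ : BQ3 𝕜 q₁ q₂ q₃ a b c α β γ lam μ ν b₁ b₂ b₃ →ₐ[𝕜] BQ3 𝕜 q₁ q₂ q₃ a b c α β γ lam μ ν b₁ b₂ b₃)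
    (h₁ : f₁ (BQ3x 𝕜 q₁ q₂ q₃ a b c α β γ lam μ ν b₁ b₂ b₃ 0) = BQ3x 𝕜 q₁ q₂ q₃ a b c α β γ lam μ ν b₁ b₂ b₃ 0 ∧
      f₁ (BQ3x 𝕜 q₁ q₂ q₃ a b c α β γ lam μ ν b₁ b₂ b₃ 1) = q₁ • BQ3x 𝕜 q₁ q₂ q₃ a b c α β γ lam μ ν b₁ b₂ b₃ 1 + algebraMap 𝕜 (BQ3 𝕜 q₁ q₂ q₃ a b c α β γ lam μ ν b₁ b₂ b₃) a ∧
      f₁ (BQ3x 𝕜 q₁ q₂ q₃ a b c α β γ lam μ ν b₁ b₂ b₃ 2) = q₂ • BQ3x 𝕜 q₁ q₂ q₃ a b c α β γ lam μ ν b₁ b₂ b₃ 2 + algebraMap 𝕜 (BQ3 𝕜 q₁ q₂ q₃ a b c α β γ lam μ ν b₁ b₂ b₃) α)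
    (h₂ : f₂ (BQ3x 𝕜 q₁ q₂ q₃ a b c α β γ lam μ ν b₁ b₂ b₃ 0) = q₁⁻¹ • BQ3x 𝕜 q₁ q₂ q₃ a b c α β γ lam μ ν b₁ b₂ b₃ 0 - algebraMap 𝕜 (BQ3 𝕜 q₁ q₂ q₃ a b c α β γ lam μ ν b₁ b₂ b₃) (b * q₁⁻¹) ∧
      f₂ (BQ3x 𝕜 q₁ q₂ q₃ a b c α β γ lam μ ν b₁ b₂ b₃ 1) = BQ3x 𝕜 q₁ q₂ q₃ a b c α β γ lam μ ν b₁ b₂ b₃ 1 ∧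
      f₂ (BQ3x 𝕜 q₁ q₂ q₃ a b c α β γ lam μ ν b₁ b₂ b₃ 2) = q₃ • BQ3x 𝕜 q₁ q₂ q₃ a b c α β γ lam μ ν b₁ b₂ b₃ 2 + algebraMap 𝕜 (BQ3 𝕜 q₁ q₂ q₃ a b c α β γ lam μ ν b₁ b₂ b₃) μ)
    (h₃ : f₃ (BQ3x 𝕜 q₁ q₂ q₃ a b c α β γ lam μ ν b₁ b₂ b₃ 0) = q₂⁻¹ • BQ3x 𝕜 q₁ q₂ q₃ a b c α β γ lam μ ν b₁ b₂ b₃ 0 - algebraMap 𝕜 (BQ3 𝕜 q₁ q₂ q₃ a b c α β γ lam μ ν b₁ b₂ b₃) (γ * q₂⁻¹) ∧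
      f₃ (BQ3x 𝕜 q₁ q₂ q₃ a b c α β γ lam μ ν b₁ b₂ b₃ 1) = q₃⁻¹ • BQ3x 𝕜 q₁ q₂ q₃ a b c α β γ lam μ ν b₁ b₂ b₃ 1 - algebraMap 𝕜 (BQ3 𝕜 q₁ q₂ q₃ a b c α β γ lam μ ν b₁ b₂ b₃) (ν * q₃⁻¹) ∧
      f₃ (BQ3x 𝕜 q₁ q₂ q₃ a b c α β γ lam μ ν b₁ b₂ b₃ 2) = BQ3x 𝕜 q₁ q₂ q₃ a b c α β γ lam μ ν b₁ b₂ b₃ 2) :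
    f₁.comp f₂ = f₂.comp f₁ ∧ f₁.comp f₃ = f₃.comp f₁ ∧ f₂.comp f₃ = f₃.comp f₂ := by
  obtain ⟨h₁₀, h₁₁, h₁₂⟩ := h₁
  obtain ⟨h₂₀, h₂₁, h₂₂⟩ := h₂
  obtain ⟨h₃₀, h₃₁, h₃₂⟩ := h₃
  rw [sub_eq_add_neg, ← map_neg] at h₂₀ h₃₀ h₃₁
  refine ⟨BQ3.algHom_ext fun i => ?_, BQ3.algHom_ext fun i => ?_, BQ3.algHom_ext fun i => ?_⟩ <;>
    fin_cases i
  · simp [h₁₀, h₂₀]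
  · simp [h₁₁, h₂₁]
  · exact AlgHom.apply_apply_comm_of_affine h₁₂ h₂₂ (by linear_combination -hB1)
  · simp [h₁₀, h₃₀]
  · exact AlgHom.apply_apply_comm_of_affine h₁₁ h₃₁
      (by field_simp; linear_combination hB2)
  · simp [h₁₂, h₃₂]
  · exact AlgHom.apply_apply_comm_of_affine h₂₀ h₃₀
      (by field_simp; linear_combination -hB3)
  · simp [h₂₁, h₃₁]
  · simp [h₂₂, h₃₂]
end
end

section
/- Let A be the bi-quadratic algebra on three generators over a field 𝕜 with parameters q₁,q₂,q₃ ∈ 𝕜 nonzero and a,b,c,α,β,γ,λ,μ,ν,b₁,b₂,b₃ ∈ 𝕜. Equip the tensor product A ⊗_𝕜 A with its standard A-bimodule structure, p·(u⊗v) = (pu)⊗v and (u⊗v)·p = u⊗(vp), and let d_u : A → A ⊗_𝕜 A be the universal differential d_u(p) = 1⊗p − p⊗1. Then: (i) if c ≠ 0, then d_u(x₃) lies in the sub-bimodule of A ⊗_𝕜 A generated by d_u(x₁) and d_u(x₂); (ii) if β ≠ 0, then d_u(x₂) lies in the sub-bimodule generated by d_u(x₁) and d_u(x₃); (iii) if λ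 ≠ 0, then d_u(x₁) lies in the sub-bimodule generated by d_u(x₂) and d_u(x₃). In particular, if c ≠ 0 or β ≠ 0 or λ ≠ 0, the sub-bimodule generated by d_u(x₁), d_u(x₂), d_u(x₃) is generated by two of these three elements. -/
noncomputable section

open FreeAlgebra

open TensorProduct in
/-- The sub-bimodule of `A ⊗[𝕜] A` generated by a set `S`: the smallest `𝕜`-submodule
containing `S` and closed under the left action `p • (u ⊗ v) = (pu) ⊗ v` and the right action
`(u ⊗ v) • p = u ⊗ (vp)`. -/
def subBimodule (𝕜 : Type*) [Field 𝕜] (A : Type*) [Ring A] [Algebra 𝕜 A]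
    (S : Set (A ⊗[𝕜] A)) : Submodule 𝕜 (A ⊗[𝕜] A) :=
  sInf {N : Submodule 𝕜 (A ⊗[𝕜] A) | S ⊆ (N : Set (A ⊗[𝕜] A)) ∧ ∀ p : A, ∀ w ∈ N,
    TensorProduct.map (LinearMap.mulLeft 𝕜 p) (LinearMap.id : A →ₗ[𝕜] A) w ∈ N ∧
    TensorProduct.map (LinearMap.id : A →ₗ[𝕜] A) (LinearMap.mulRight 𝕜 p) w ∈ N}

open TensorProduct in
/-- The universal differential `d_u(p) = 1 ⊗ p − p ⊗ 1`. -/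
def du (𝕜 : Type*) [Field 𝕜] (A : Type*) [Ring A] [Algebra 𝕜 A] (p : A) : A ⊗[𝕜] A :=
  (1 : A) ⊗ₜ[𝕜] p - p ⊗ₜ[𝕜] (1 : A)

section

variable {𝕜 : Type*} [Field 𝕜] {A : Type*} [Ring A] [Algebra 𝕜 A]

theorem subset_subBimodule (S : Set (TensorProduct 𝕜 A A)) :
    S ⊆ (subBimodule 𝕜 A S : Set (TensorProduct 𝕜 A A)) := fun _ hw =>
  Submodule.mem_sInf.2 fun _ hN => hN.1 hw

theorem subBimodule_map_mulLeft_mem {S : Set (TensorProduct 𝕜 A A)} (p : A)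
    {w : TensorProduct 𝕜 A A} (hw : w ∈ subBimodule 𝕜 A S) :
    TensorProduct.map (LinearMap.mulLeft 𝕜 p) LinearMap.id w ∈ subBimodule 𝕜 A S :=
  Submodule.mem_sInf.2 fun N hN => (hN.2 p w (Submodule.mem_sInf.1 hw N hN)).1

theorem subBimodule_map_mulRight_mem {S : Set (TensorProduct 𝕜 A A)} (p : A)
    {w : TensorProduct 𝕜 A A} (hw : w ∈ subBimodule 𝕜 A S) :
    TensorProduct.map LinearMap.id (LinearMap.mulRight 𝕜 p) w ∈ subBimodule 𝕜 A S :=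
  Submodule.mem_sInf.2 fun N hN => (hN.2 p w (Submodule.mem_sInf.1 hw N hN)).2

theorem subBimodule_le_subBimodule_iff {S T : Set (TensorProduct 𝕜 A A)} :
    subBimodule 𝕜 A S ≤ subBimodule 𝕜 A T ↔
      S ⊆ (subBimodule 𝕜 A T : Set (TensorProduct 𝕜 A A)) :=
  ⟨fun h => (subset_subBimodule S).trans h, fun h => sInf_le ⟨h, fun p _ hw =>
    ⟨subBimodule_map_mulLeft_mem p hw, subBimodule_map_mulRight_mem p hw⟩⟩⟩

theorem subBimodule_eq_of_subset {S T : Set (TensorProduct 𝕜 A A)} (hTS : T ⊆ S)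
    (hST : S ⊆ (subBimodule 𝕜 A T : Set (TensorProduct 𝕜 A A))) :
    subBimodule 𝕜 A S = subBimodule 𝕜 A T :=
  le_antisymm (subBimodule_le_subBimodule_iff.2 hST)
    (subBimodule_le_subBimodule_iff.2 (hTS.trans (subset_subBimodule S)))

theorem du_add (p r : A) : du 𝕜 A (p + r) = du 𝕜 A p + du 𝕜 A r := by
  simp only [du, TensorProduct.tmul_add, TensorProduct.add_tmul]
  abel

theorem du_algebraMap (t : 𝕜) : du 𝕜 A (algebraMap 𝕜 A t) = 0 := by
  simp [du, Algebra.algebraMap_eq_smul_one, TensorProduct.smul_tmul]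

/-- The Leibniz rule for the universal differential. -/
theorem du_mul (p r : A) : du 𝕜 A (p * r) =
    TensorProduct.map LinearMap.id (LinearMap.mulRight 𝕜 r) (du 𝕜 A p) +
      TensorProduct.map (LinearMap.mulLeft 𝕜 p) LinearMap.id (du 𝕜 A r) := by
  simp [du]

theorem du_mem_subBimodule_of_mem_adjoin {S : Set A} {p : A} (hp : p ∈ Algebra.adjoin 𝕜 S) :
    du 𝕜 A p ∈ subBimodule 𝕜 A (du 𝕜 A '' S) := by
  induction hp using Algebra.adjoin_induction with
  | mem x hx => exact subset_subBimodule _ (Set.mem_image_of_mem _ hx)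
  | algebraMap t => rw [du_algebraMap]; exact zero_mem _
  | add x y _ _ hx hy => rw [du_add]; exact add_mem hx hy
  | mul x y _ _ hx hy =>
    rw [du_mul]
    exact add_mem (subBimodule_map_mulRight_mem y hx) (subBimodule_map_mulLeft_mem x hy)

/-- If a quadratic relation between `x` and `y` involves `z` linearly with nonzero coefficient,
then the universal differential of `z` is generated by those of `x` and `y`. -/
theorem du_mem_subBimodule_pair {x y z : A} {q r s t e : 𝕜} (ht : t ≠ 0)
    (h : y * x = q • (x * y) + r • x + s • y + t • z + algebraMap 𝕜 A e) :
    du 𝕜 A z ∈ subBimodule 𝕜 A {du 𝕜 A x, du 𝕜 A y} := by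
  rw [← Set.image_pair]
  apply du_mem_subBimodule_of_mem_adjoin
  have hx : x ∈ Algebra.adjoin 𝕜 {x, y} := Algebra.subset_adjoin (by simp)
  have hy : y ∈ Algebra.adjoin 𝕜 {x, y} := Algebra.subset_adjoin (by simp)
  have hz : z = t⁻¹ • (y * x - (q • (x * y) + r • x + s • y + algebraMap 𝕜 A e)) := by
    rw [eq_inv_smul_iff₀ ht, h]
    abel
  rw [hz]
  exact Subalgebra.smul_mem _ (sub_mem (mul_mem hy hx) (add_mem (add_mem (add_mem
    (Subalgebra.smul_mem _ (mul_mem hx hy) q) (Subalgebra.smul_mem _ hx r))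
    (Subalgebra.smul_mem _ hy s)) (Subalgebra.algebraMap_mem _ e))) _

end

/-- If `c ≠ 0` (resp. `β ≠ 0`, `λ ≠ 0`) then `d_u(x₃)` (resp. `d_u(x₂)`, `d_u(x₁)`) lies in the
sub-bimodule generated by the universal differentials of the other two generators; in particular
the sub-bimodule generated by the three differentials is generated by two of them. -/
theorem biquadratic_du_dependent (𝕜 : Type*) [Field 𝕜] (q₁ q₂ q₃ a b c α β γ lam μ ν b₁ b₂ b₃ : 𝕜)
    (hq₁ : q₁ ≠ 0) (hq₂ : q₂ ≠ 0) (hq₃ : q₃ ≠ 0) :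
    (c ≠ 0 → du 𝕜 (BQ3 𝕜 q₁ q₂ q₃ a b c α β γ lam μ ν b₁ b₂ b₃) (BQ3x 𝕜 q₁ q₂ q₃ a b c α β γ lam μ ν b₁ b₂ b₃ 2) ∈
      subBimodule 𝕜 (BQ3 𝕜 q₁ q₂ q₃ a b c α β γ lam μ ν b₁ b₂ b₃) {du 𝕜 (BQ3 𝕜 q₁ q₂ q₃ a b c α β γ lam μ ν b₁ b₂ b₃) (BQ3x 𝕜 q₁ q₂ q₃ a b c α β γ lam μ ν b₁ b₂ b₃ 0), du 𝕜 (BQ3 𝕜 q₁ q₂ q₃ a b c α β γ lam μ ν b₁ b₂ b₃) (BQ3x 𝕜 q₁ q₂ q₃ a b c α β γ lam μ ν b₁ b₂ b₃ 1)}) ∧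
    (β ≠ 0 → du 𝕜 (BQ3 𝕜 q₁ q₂ q₃ a b c α β γ lam μ ν b₁ b₂ b₃) (BQ3x 𝕜 q₁ q₂ q₃ a b c α β γ lam μ ν b₁ b₂ b₃ 1) ∈
      subBimodule 𝕜 (BQ3 𝕜 q₁ q₂ q₃ a b c α β γ lam μ ν b₁ b₂ b₃) {du 𝕜 (BQ3 𝕜 q₁ q₂ q₃ a b c α β γ lam μ ν b₁ b₂ b₃) (BQ3x 𝕜 q₁ q₂ q₃ a b c α β γ lam μ ν b₁ b₂ b₃ 0), du 𝕜 (BQ3 𝕜 q₁ q₂ q₃ a b c α β γ lam μ ν b₁ b₂ b₃) (BQ3x 𝕜 q₁ q₂ q₃ a b c α β γ lam μ ν b₁ b₂ b₃ 2)}) ∧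
    (lam ≠ 0 → du 𝕜 (BQ3 𝕜 q₁ q₂ q₃ a b c α β γ lam μ ν b₁ b₂ b₃) (BQ3x 𝕜 q₁ q₂ q₃ a b c α β γ lam μ ν b₁ b₂ b₃ 0) ∈
      subBimodule 𝕜 (BQ3 𝕜 q₁ q₂ q₃ a b c α β γ lam μ ν b₁ b₂ b₃) {du 𝕜 (BQ3 𝕜 q₁ q₂ q₃ a b c α β γ lam μ ν b₁ b₂ b₃) (BQ3x 𝕜 q₁ q₂ q₃ a b c α β γ lam μ ν b₁ b₂ b₃ 1), du 𝕜 (BQ3 𝕜 q₁ q₂ q₃ a b c α β γ lam μ ν b₁ b₂ b₃) (BQ3x 𝕜 q₁ q₂ q₃ a b c α β γ lam μ ν b₁ b₂ b₃ 2)}) ∧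
    ((c ≠ 0 ∨ β ≠ 0 ∨ lam ≠ 0) →
      ∃ u v : TensorProduct 𝕜 (BQ3 𝕜 q₁ q₂ q₃ a b c α β γ lam μ ν b₁ b₂ b₃) (BQ3 𝕜 q₁ q₂ q₃ a b c α β γ lam μ ν b₁ b₂ b₃),
        u ∈ ({du 𝕜 (BQ3 𝕜 q₁ q₂ q₃ a b c α β γ lam μ ν b₁ b₂ b₃) (BQ3x 𝕜 q₁ q₂ q₃ a b c α β γ lam μ ν b₁ b₂ b₃ 0), du 𝕜 (BQ3 𝕜 q₁ q₂ q₃ a b c α β γ lam μ ν b₁ b₂ b₃) (BQ3x 𝕜 q₁ q₂ q₃ a b c α β γ lam μ ν b₁ b₂ b₃ 1), du 𝕜 (BQ3 𝕜 q₁ q₂ q₃ a b c α β γ lam μ ν b₁ b₂ b₃) (BQ3x 𝕜 q₁ q₂ q₃ a b c α β γ lam μ ν b₁ b₂ b₃ 2)} : Set (TensorProduct 𝕜 (BQ3 𝕜 q₁ q₂ q₃ a b c α β γ lam μ ν b₁ b₂ b₃) (BQ3 𝕜 q₁ q₂ q₃ a b c α β γ lam μ ν b₁ b₂ b₃))) 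∧
        v ∈ ({du 𝕜 (BQ3 𝕜 q₁ q₂ q₃ a b c α β γ lam μ ν b₁ b₂ b₃) (BQ3x 𝕜 q₁ q₂ q₃ a b c α β γ lam μ ν b₁ b₂ b₃ 0), du 𝕜 (BQ3 𝕜 q₁ q₂ q₃ a b c α β γ lam μ ν b₁ b₂ b₃) (BQ3x 𝕜 q₁ q₂ q₃ a b c α β γ lam μ ν b₁ b₂ b₃ 1), du 𝕜 (BQ3 𝕜 q₁ q₂ q₃ a b c α β γ lam μ ν b₁ b₂ b₃) (BQ3x 𝕜 q₁ q₂ q₃ a b c α β γ lam μ ν b₁ b₂ b₃ 2)} : Set (TensorProduct 𝕜 (BQ3 𝕜 q₁ q₂ q₃ a b c α β γ lam μ ν b₁ b₂ b₃) (BQ3 𝕜 q₁ q₂ q₃ a b c α β γ lam μ ν b₁ b₂ b₃))) ∧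
        subBimodule 𝕜 (BQ3 𝕜 q₁ q₂ q₃ a b c α β γ lam μ ν b₁ b₂ b₃) {du 𝕜 (BQ3 𝕜 q₁ q₂ q₃ a b c α β γ lam μ ν b₁ b₂ b₃) (BQ3x 𝕜 q₁ q₂ q₃ a b c α β γ lam μ ν b₁ b₂ b₃ 0), du 𝕜 (BQ3 𝕜 q₁ q₂ q₃ a b c α β γ lam μ ν b₁ b₂ b₃) (BQ3x 𝕜 q₁ q₂ q₃ a b c α β γ lam μ ν b₁ b₂ b₃ 1), du 𝕜 (BQ3 𝕜 q₁ q₂ q₃ a b c α β γ lam μ ν b₁ b₂ b₃) (BQ3x 𝕜 q₁ q₂ q₃ a b c α β γ lam μ ν b₁ b₂ b₃ 2)} =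
          subBimodule 𝕜 (BQ3 𝕜 q₁ q₂ q₃ a b c α β γ lam μ ν b₁ b₂ b₃) {u, v}) := by
  have rel {u v} (h : BQ3Rel 𝕜 q₁ q₂ q₃ a b c α β γ lam μ ν b₁ b₂ b₃ u v) :=
    RingQuot.mkAlgHom_rel 𝕜 h
  have h₁ := rel (Or.inl ⟨rfl, rfl⟩)
  have h₂ := rel (Or.inr (Or.inl ⟨rfl, rfl⟩))
  have h₃ := rel (Or.inr (Or.inr ⟨rfl, rfl⟩))
  simp only [map_add, map_mul, map_smul, AlgHom.commutes] at h₁ h₂ h₃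
  have mem₂ (hc : c ≠ 0) := du_mem_subBimodule_pair hc h₁
  have mem₁ (hβ : β ≠ 0) := du_mem_subBimodule_pair hβ ((h₂.trans (by abel) :
    _ = q₂ • _ + α • _ + γ • _ + β • _ + algebraMap 𝕜 _ b₂))
  have mem₀ (hl : lam ≠ 0) := du_mem_subBimodule_pair hl ((h₃.trans (by abel) :
    _ = q₃ • _ + μ • _ + ν • _ + lam • _ + algebraMap 𝕜 _ b₃))
  refine ⟨mem₂, mem₁, mem₀, ?_⟩
  rintro (hc | hβ | hl)
  · refine ⟨_, _, Or.inl rfl, Or.inr (Or.inl rfl), subBimodule_eq_of_subset ?_ ?_⟩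
    · rintro _ (rfl | rfl) <;> simp
    · rintro _ (rfl | rfl | rfl)
      exacts [subset_subBimodule _ (Or.inl rfl), subset_subBimodule _ (Or.inr rfl), mem₂ hc]
  · refine ⟨_, _, Or.inl rfl, Or.inr (Or.inr rfl), subBimodule_eq_of_subset ?_ ?_⟩
    · rintro _ (rfl | rfl) <;> simp
    · rintro _ (rfl | rfl | rfl)
      exacts [subset_subBimodule _ (Or.inl rfl), mem₁ hβ, subset_subBimodule _ (Or.inr rfl)]
  · refine ⟨_, _, Or.inr (Or.inl rfl), Or.inr (Or.inr rfl), subBimodule_eq_of_subset ?_ ?_⟩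
    · rintro _ (rfl | rfl) <;> simp
    · rintro _ (rfl | rfl | rfl)
      exacts [mem₀ hl, subset_subBimodule _ (Or.inl rfl), subset_subBimodule _ (Or.inr rfl)]
end
end
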